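/- arXiv:2511.04058 — 7 statements merged into one kernel-verified Lean document; each statement's English description precedes it below -/
import Mathlib

section
/- Let δ ∈ (0,1] and λ > 0 satisfy λ < 1/(√(2δ)+√(1−δ))². Then there exist real numbers x and y with 0 < x < 1, 1 < y, λ(1−δ)·y < 1, x·y = 1, and (2x/(1−x)) · (δλy/(1−(1−δ)λy)) < 1. -/
/-- For `δ ∈ (0,1]` and `0 < λ < 1/(√(2δ)+√(1−δ))²` there exist `x, y` with
`0 < x < 1`, `1 < y`, `λ(1−δ)y < 1`, `xy = 1` and `(2x/(1−x))·(δλy/(1−(1−δ)λy)) < 1`. -/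
theorem stmt1 (δ lam : ℝ) (hδ0 : 0 < δ) (hδ1 : δ ≤ 1) (hlam0 : 0 < lam)
    (hlam : lam < 1 / (Real.sqrt (2*δ) + Real.sqrt (1-δ))^2) :
    ∃ x y : ℝ, 0 < x ∧ x < 1 ∧ 1 < y ∧ lam * (1-δ) * y < 1 ∧ x * y = 1 ∧
      (2*x/(1-x)) * (δ*lam*y/(1-(1-δ)*lam*y)) < 1 := by
  obtain ⟨a, ha⟩ : ∃ a, a = Real.sqrt (2*δ) := ⟨_, rfl⟩
  obtain ⟨b, hb⟩ : ∃ b, b = Real.sqrt (1-δ) := ⟨_, rfl⟩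
  obtain ⟨s, hs⟩ : ∃ s, s = Real.sqrt lam := ⟨_, rfl⟩
  have ha0 : 0 < a := by rw [ha]; positivity
  have hb0 : 0 ≤ b := by rw [hb]; positivity
  have hs0 : 0 < s := by rw [hs]; positivity
  have ha2 : a^2 = 2*δ := by rw [ha]; exact Real.sq_sqrt (by linarith)
  have hb2 : b^2 = 1-δ := by rw [hb]; exact Real.sq_sqrt (by linarith)
  have hs2 : s^2 = lam := by rw [hs]; exact Real.sq_sqrt hlam0.le
  rw [← ha, ← hb, lt_div_iff₀ (by positivity), ← hs2, ← mul_pow] at hlam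
  have h1 : s * (a + b) < 1 := by
    by_contra h
    push Not at h
    nlinarith
  obtain ⟨p, hp⟩ : ∃ p, p = a * s := ⟨_, rfl⟩
  obtain ⟨q, hq⟩ : ∃ q, q = b * s := ⟨_, rfl⟩
  have hp0 : 0 < p := by rw [hp]; positivity
  have hq0 : 0 ≤ q := by rw [hq]; positivity
  have hpq : p + q < 1 := by rw [hp, hq]; linarith
  have hp2 : p^2 = 2*δ*lam := by rw [hp, mul_pow, ha2, hs2]
  have hq2 : q^2 = (1-δ)*lam := by rw [hq, mul_pow, hb2, hs2]
  have hd : δ*lam = p^2/2 := by linarith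
  obtain ⟨x, hx⟩ : ∃ x, x = (1 + q^2 - p^2)/2 := ⟨_, rfl⟩
  have hpq2 : 0 < (1-(p+q))*(1+(p+q)) := mul_pos (by linarith) (by linarith)
  have hpqm : 0 ≤ p*q := by positivity
  have hpp : 0 < p^2 := by positivity
  have hqq : 0 ≤ q^2 := by positivity
  have hx1 : x < 1 := by rw [hx]; linarith
  have hxq : q^2 < x := by rw [hx]; linarith
  have hx0 : 0 < x := by linarith
  have key : p^2 * x < (1-x)*(x-q^2) := by
    have e : (1-x)*(x-q^2) - p^2*x = ((1-q)^2-p^2)*((1+q)^2-p^2)/4 := by rw [hx]; ring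
    have h2 : 0 < (1-q)^2-p^2 := by
      have : 0 < (1-q-p)*(1-q+p) := mul_pos (by linarith) (by linarith)
      linarith
    have h3 : 0 < (1+q)^2-p^2 := by
      have : 0 < (1+q-p)*(1+q+p) := mul_pos (by linarith) (by linarith)
      linarith
    have := mul_pos h2 h3
    linarith
  refine ⟨x, x⁻¹, hx0, hx1, (one_lt_inv₀ hx0).2 hx1, ?_, mul_inv_cancel₀ hx0.ne', ?_⟩
  · rw [mul_comm lam, ← hq2, ← div_eq_mul_inv, div_lt_one hx0]; exact hxq
  · rw [← hq2, hd]
    have h4 : 0 < 1 - x := by linarith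
    have h5 : 0 < x - q^2 := by linarith
    have e : (2*x/(1-x)) * (p^2/2*x⁻¹/(1-q^2*x⁻¹)) = p^2*x/((1-x)*(x-q^2)) := by
      have : 1-q^2*x⁻¹ = (x-q^2)/x := by field_simp
      rw [this]
      field_simp
    rw [e, div_lt_one (mul_pos h4 h5)]
    exact key
end

section
/- Let δ ∈ (0,1] and λ > 0 satisfy λ > 1/(√(2δ)+√(1−δ))². Then for every pair of real numbers x, y with 0 < x < 1, 1 < y, λ(1−δ)·y < 1 and x·y = 1, one has (2x/(1−x)) · (δλy/(1−(1−δ)λy)) > 1. -/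
/-- For `δ ∈ (0,1]` and `λ > 1/(√(2δ)+√(1−δ))²`, every pair `x, y` with
`0 < x < 1`, `1 < y`, `λ(1−δ)y < 1` and `xy = 1` satisfies
`(2x/(1−x))·(δλy/(1−(1−δ)λy)) > 1`. -/
theorem stmt2 (δ lam : ℝ) (hδ0 : 0 < δ) (hδ1 : δ ≤ 1) (hlam0 : 0 < lam)
    (hlam : 1 / (Real.sqrt (2*δ) + Real.sqrt (1-δ))^2 < lam) :
    ∀ x y : ℝ, 0 < x → x < 1 → 1 < y → lam * (1-δ) * y < 1 → x * y = 1 →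
      1 < (2*x/(1-x)) * (δ*lam*y/(1-(1-δ)*lam*y)) := by
  intro x y hx0 hx1 hy h1 hxy
  have ha : Real.sqrt (2*δ) ^ 2 = 2*δ := Real.sq_sqrt (by linarith)
  have hb : Real.sqrt (1-δ) ^ 2 = 1-δ := Real.sq_sqrt (by linarith)
  have ha0 : 0 < Real.sqrt (2*δ) := Real.sqrt_pos.mpr (by linarith)
  have hb0 : 0 ≤ Real.sqrt (1-δ) := Real.sqrt_nonneg _
  generalize Real.sqrt (2*δ) = a at *
  generalize Real.sqrt (1-δ) = b at *
  have hl : 1 < lam * (a+b)^2 := by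
    rwa [div_lt_iff₀ (by positivity)] at hlam
  have hd : 0 < 1 - (1-δ)*lam*y := by linarith [mul_comm lam (1-δ)]
  have ht : 0 < 1 - x := by linarith
  rw [div_mul_div_comm, one_lt_div (mul_pos ht hd)]
  have key : x*(1-x) < lam * (2*δ*x + (1-δ)*(1-x)) := by
    have e : 2*δ*x + (1-δ)*(1-x) = x*(1-x)*(a+b)^2 + (a*x-b*(1-x))^2 := by
      rw [← ha, ← hb]; ring
    rw [e]
    nlinarith [mul_pos (mul_pos hx0 ht) (sub_pos.mpr hl),
      mul_nonneg hlam0.le (sq_nonneg (a*x-b*(1-x)))]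
  have e1 : 2*x*(δ*lam*y) = 2*δ*lam := by linear_combination (2*δ*lam)*hxy
  rw [e1]
  refine lt_of_mul_lt_mul_left ?_ hx0.le
  have e2 : x*((1-x)*(1-(1-δ)*lam*y)) = x*(1-x) - (1-x)*(1-δ)*lam := by
    linear_combination (-(1-x)*(1-δ)*lam)*hxy
  rw [e2]
  linarith
end

section
/- Let δ ∈ (0,1] and 0 < λ < 1/(√(2δ)+√(1−δ))². Then there exists a constant C (depending only on δ and λ) such that for every natural number n with n ≥ λ, every subset S of an n-element vertex set with |S| = ⌊δn⌋, and every 2-factor h on S, the conditional planted model G satisfies E[ max_H |edges(h) Δ edges(H)| ] ≤ C, where the maximum ranges over all 2-factors H on some vertex subset of size ⌊δn⌋ all of whose edges are contained in G (this maximum is over a nonempty finite set since h itself qualifies), and Δ denotes symmetric difference of edge sets. -/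
open Finset

/-- `h` is a 2-factor on the vertex subset `S`: every vertex of `S` has exactly two
neighbors and every vertex outside `S` has none. -/
def IsTwoFactorOn {V : Type*} (h : SimpleGraph V) (S : Finset V) : Prop :=
  (∀ v ∈ S, Nat.card {w : V // h.Adj v w} = 2) ∧
  (∀ v ∉ S, Nat.card {w : V // h.Adj v w} = 0)

/-- The "slots" of the conditional planted model: unordered pairs of distinct vertices
that are not planted edges. Each slot is independently open with probability `λ/n`. -/
abbrev Slot {V : Type*} (h : SimpleGraph V) : Type _ :=
  {e : Sym2 V // ¬ e.IsDiag ∧ e ∉ h.edgeSet}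

namespace PC

lemma exp_open {ι : Type*} [Fintype ι] [DecidableEq ι] (p : ℝ) (B : Finset ι) :
    ∑ ω : ι → Bool, (∏ e, (if ω e = true then p else 1 - p)) *
      (if ∀ e ∈ B, ω e = true then (1:ℝ) else 0) = p ^ B.card := by
  have h1 : ∀ ω : ι → Bool, (if ∀ e ∈ B, ω e = true then (1:ℝ) else 0)
      = ∏ e, (if e ∈ B ∧ ω e = false then (0:ℝ) else 1) := by
    intro ω
    split_ifs with h
    · symm
      apply Finset.prod_eq_one
      intro e _
      rw [if_neg]
      rintro ⟨h1, h2⟩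
      rw [h e h1] at h2
      cases h2
    · push Not at h
      obtain ⟨e, he, h2⟩ := h
      symm
      apply Finset.prod_eq_zero (Finset.mem_univ e)
      rw [if_pos]
      exact ⟨he, by simpa using h2⟩
  simp_rw [h1, ← Finset.prod_mul_distrib]
  have := Finset.prod_univ_sum (fun _ : ι => (Finset.univ : Finset Bool))
    (fun (e : ι) (b : Bool) => (if b = true then p else 1 - p) *
      (if e ∈ B ∧ b = false then (0:ℝ) else 1))
  rw [Fintype.piFinset_univ] at this
  rw [← this]
  have h2 : ∀ e : ι, (∑ b : Bool, (if b = true then p else 1 - p) *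
      (if e ∈ B ∧ b = false then (0:ℝ) else 1)) = if e ∈ B then p else 1 := by
    intro e
    by_cases he : e ∈ B <;> simp [he]
  simp_rw [h2]
  simp

lemma params (δ : ℝ) (hδ0 : 0 < δ) (hδ1 : δ ≤ 1) (lam : ℝ) (hlam0 : 0 < lam)
    (hlam : lam < 1 / (Real.sqrt (2*δ) + Real.sqrt (1-δ))^2) :
    ∃ x : ℝ, 0 < x ∧ x < 1 ∧ lam * (2 * δ / (1 - x) + (1 - δ) / x) < 1 := by
  set a := Real.sqrt (2*δ) with ha
  set b := Real.sqrt (1-δ) with hb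
  have ha0 : 0 < a := Real.sqrt_pos.mpr (by linarith)
  have hb0 : 0 ≤ b := Real.sqrt_nonneg _
  have ha2 : a^2 = 2*δ := Real.sq_sqrt (by linarith)
  have hb2 : b^2 = 1-δ := Real.sq_sqrt (by linarith)
  have hl : lam * (a+b)^2 < 1 := by
    rwa [lt_div_iff₀ (by positivity)] at hlam
  rw [← ha2, ← hb2]
  rcases hb0.eq_or_lt with h | h
  · rw [← h] at hl ⊢
    have : a^2 = 2 := by rw [ha2]; rw [← h] at hb2; linarith
    have h2 : lam * 2 < 1 := by rw [← this]; simpa using hl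
    refine ⟨(1 - 2*lam)/2, by linarith, by linarith, ?_⟩
    rw [this]
    have : 1 - (1 - 2*lam)/2 = (1+2*lam)/2 := by ring
    rw [this]
    simp only [ne_eq, OfNat.ofNat_ne_zero, not_false_eq_true, zero_pow, zero_div, add_zero]
    rw [← mul_div_assoc, div_lt_one (by linarith)]
    linarith
  · refine ⟨b/(a+b), by positivity, ?_, ?_⟩
    · rw [div_lt_one (by positivity)]; linarith
    · have : 1 - b/(a+b) = a/(a+b) := by field_simp; ring
      rw [this]
      have : a^2 / (a/(a+b)) + b^2/(b/(a+b)) = (a+b)^2 := by field_simp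
      rw [this]; exact hl

lemma params2 (δ : ℝ) (hδ0 : 0 < δ) (hδ1 : δ ≤ 1) (lam : ℝ) (hlam0 : 0 < lam)
    (hlam : lam < 1 / (Real.sqrt (2*δ) + Real.sqrt (1-δ))^2) :
    ∃ (x z : ℝ) (n0 : ℕ), 0 < x ∧ x < 1 ∧ 1 < z ∧ 0 < n0 ∧
      z * lam * (2 * δ / (1 - x) + (1 - δ + 1 / n0) / x) < 1 := by
  obtain ⟨x, hx0, hx1, h⟩ := params δ hδ0 hδ1 lam hlam0 hlam
  set c := lam * (2 * δ / (1 - x) + (1 - δ) / x) with hc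
  have hx1' : 0 < 1 - x := by linarith
  have hc0 : 0 < c := by
    have : 0 ≤ 1 - δ := by linarith
    positivity
  obtain ⟨n0, hn0⟩ := exists_nat_gt (lam / (x * (1 - c)))
  have h1c : 0 < 1 - c := by linarith
  have hn0' : (0:ℝ) < n0 := lt_trans (by positivity) hn0
  have h3 : lam * (1 / n0 / x) < 1 - c := by
    rw [div_lt_iff₀ (by positivity)] at hn0
    rw [div_div, ← mul_div_assoc, div_lt_iff₀ (by positivity)]
    nlinarith
  set c' := c + lam * (1 / n0 / x) with hc'
  have hc'0 : 0 < c' := by positivity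
  have hc'1 : c' < 1 := by linarith
  refine ⟨x, (1 + 1/c')/2, n0, hx0, hx1, ?_, by exact_mod_cast hn0', ?_⟩
  · have : 1 < 1 / c' := by rw [lt_div_iff₀ hc'0]; linarith
    linarith
  · have : (1 + 1/c')/2 * lam * (2 * δ / (1 - x) + (1 - δ + 1 / n0) / x)
       = (1 + 1/c')/2 * c' := by
      rw [hc', hc, add_div]; ring
    rw [this]
    have : (1 + 1/c')/2 * c' = (c' + 1)/2 := by field_simp
    rw [this]; linarith

open scoped Classical

def edgesL {V : Type*} : V → List V → List (Sym2 V)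
  | _, [] => []
  | v, w :: l => s(v, w) :: edgesL w l

def Allowed {V : Type*} (h : SimpleGraph V) (S : Finset V) (p v w : V) : Prop :=
  (h.Adj p v → w ≠ p) ∧ (¬ h.Adj p v → v ∈ S → h.Adj v w)

def Valid {V : Type*} (h : SimpleGraph V) (S : Finset V) : V → V → List V → Prop
  | _, _, [] => True
  | p, v, w :: l => Allowed h S p v w ∧ Valid h S v w l

noncomputable def LL (V : Type*) [Fintype V] : ℕ → Finset (List V)
  | 0 => ∅
  | M + 1 => insert [] ((Finset.univ ×ˢ LL V M).image (fun a : V × List V => a.1 :: a.2))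

lemma mem_LL {V : Type*} [Fintype V] (M : ℕ) (l : List V) : l ∈ LL V M ↔ l.length < M := by
  induction M generalizing l with
  | zero => simp [LL]
  | succ M ih =>
    cases l with
    | nil => simp [LL]
    | cons a l => simp [LL, ih]

lemma sum_LL {V : Type*} [Fintype V] (M : ℕ) (f : List V → ℝ) :
    ∑ l ∈ LL V (M+1), f l = f [] + ∑ w : V, ∑ l ∈ LL V M, f (w :: l) := by
  rw [LL, Finset.sum_insert (by simp), Finset.sum_image, Finset.sum_product]
  rintro ⟨a, b⟩ _ ⟨c, d⟩ _ h
  simpa using h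

noncomputable def ew {V : Type*} (h : SimpleGraph V) (x y : ℝ) (e : Sym2 V) : ℝ :=
  if e ∈ h.edgeSet then x else y

noncomputable def W {V : Type*} (h : SimpleGraph V) (x y : ℝ) (E : List (Sym2 V)) : ℝ :=
  (E.map (ew h x y)).prod

noncomputable def Phi {V : Type*} (h : SimpleGraph V) (S : Finset V) (r aS aO : ℝ) (p v : V) : ℝ :=
  if h.Adj p v then r else if v ∈ S then aS else aO

lemma W_nonneg {V : Type*} (h : SimpleGraph V) (x y : ℝ) (hx : 0 ≤ x) (hy : 0 ≤ y)
    (E : List (Sym2 V)) : 0 ≤ W h x y E := by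
  apply List.prod_nonneg
  intro a ha
  simp only [List.mem_map] at ha
  obtain ⟨e, _, rfl⟩ := ha
  unfold ew; split_ifs <;> assumption

lemma adj_card {V : Type*} [Fintype V] {h : SimpleGraph V} {S : Finset V}
    (hh : IsTwoFactorOn h S) (v : V) :
    (Finset.univ.filter (fun w => h.Adj v w)).card = if v ∈ S then 2 else 0 := by
  rw [← Fintype.card_subtype, ← Nat.card_eq_fintype_card]
  split_ifs with hv
  · exact hh.1 v hv
  · exact hh.2 v hv

lemma mem_of_adj {V : Type*} [Fintype V] {h : SimpleGraph V} {S : Finset V}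
    (hh : IsTwoFactorOn h S) {v w : V} (hvw : h.Adj v w) : v ∈ S := by
  by_contra hv
  have := adj_card hh v
  rw [if_neg hv, Finset.card_eq_zero] at this
  have h2 : w ∈ Finset.univ.filter (fun w => h.Adj v w) := by simp [hvw]
  rw [this] at h2
  simp at h2

lemma step_sum {V : Type*} [Fintype V] {h : SimpleGraph V} {S : Finset V}
    (hh : IsTwoFactorOn h S) (x q r aS aO : ℝ) (hx : 0 ≤ x) (hq : 0 ≤ q) (hr : 0 ≤ r)
    (haS : 0 ≤ aS) (haO : 0 ≤ aO)
    (h1 : 1 + 2 * x * r ≤ aS)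
    (h2 : 1 + x * r + q * (S.card * aS + Sᶜ.card * aO) ≤ r)
    (h3 : 1 + q * (S.card * aS + Sᶜ.card * aO) ≤ aO) (p v : V) :
    1 + ∑ w, (if Allowed h S p v w then ew h x q s(v, w) * Phi h S r aS aO v w else 0)
      ≤ Phi h S r aS aO p v := by
  have key : ∑ w : V, q * (if w ∈ S then aS else aO) = q * (S.card * aS + Sᶜ.card * aO) := by
    rw [← Finset.mul_sum, Finset.sum_ite]
    congr 1
    simp only [Finset.sum_const, nsmul_eq_mul]
    congr 3
    · congr 1; ext; simp
    · congr 1; ext; simp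
  have nn : ∀ w : V, 0 ≤ q * (if w ∈ S then aS else aO) := by
    intro w; split_ifs <;> positivity
  by_cases hpv : h.Adj p v
  · rw [show Phi h S r aS aO p v = r by simp [Phi, hpv]]
    have hv : v ∈ S := mem_of_adj hh hpv.symm
    have hc : (Finset.univ.filter (fun w => h.Adj v w ∧ w ≠ p)).card = 1 := by
      have := adj_card hh v
      rw [if_pos hv] at this
      have h4 : (Finset.univ.filter (fun w => h.Adj v w ∧ w ≠ p))
        = (Finset.univ.filter (fun w => h.Adj v w)).erase p := by
        ext w; simp [and_comm]
      rw [h4, Finset.card_erase_of_mem (by simp [hpv.symm]), this]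
    have : ∑ w, (if Allowed h S p v w then ew h x q s(v, w) * Phi h S r aS aO v w else 0)
        ≤ ∑ w, ((if h.Adj v w ∧ w ≠ p then x * r else 0) + q * (if w ∈ S then aS else aO)) := by
      apply Finset.sum_le_sum
      intro w _
      have := nn w
      have hxr : 0 ≤ x * r := by positivity
      by_cases hw : h.Adj v w
      · by_cases hwp : w = p
        · simp [Allowed, hpv, hwp]; simpa [hwp] using this
        · simp only [Allowed, hpv, hw, hwp, ew, Phi, SimpleGraph.mem_edgeSet]
          simp
          split_ifs <;> positivity
      · simp only [hw, ew, Phi, SimpleGraph.mem_edgeSet]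
        split_ifs <;> simp_all
    have h6 : ∑ w, (if h.Adj v w ∧ w ≠ p then x * r else 0) = x * r := by
      rw [← Finset.sum_filter, Finset.sum_const, hc, one_smul]
    rw [Finset.sum_add_distrib, key, h6] at this
    linarith
  · by_cases hv : v ∈ S
    · rw [show Phi h S r aS aO p v = aS by simp [Phi, hpv, hv]]
      have : ∑ w, (if Allowed h S p v w then ew h x q s(v, w) * Phi h S r aS aO v w else 0)
        = ∑ w, (if h.Adj v w then x * r else 0) := by
        apply Finset.sum_congr rfl
        intro w _
        by_cases hw : h.Adj v w
        · simp [Allowed, hpv, hv, hw, ew, Phi]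
        · simp [Allowed, hpv, hv, hw]
      rw [this, ← Finset.sum_filter, Finset.sum_const, adj_card hh, if_pos hv]
      simp only [nsmul_eq_mul, Nat.cast_ofNat]
      linarith
    · rw [show Phi h S r aS aO p v = aO by simp [Phi, hpv, hv]]
      have : ∑ w, (if Allowed h S p v w then ew h x q s(v, w) * Phi h S r aS aO v w else 0)
        = ∑ w, q * (if w ∈ S then aS else aO) := by
        apply Finset.sum_congr rfl
        intro w _
        have hw : ¬ h.Adj v w := fun hw => hv (mem_of_adj hh hw)
        simp [Allowed, hpv, hv, hw, ew, Phi]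
      rw [this, key]
      exact h3

lemma walk_sum {V : Type*} [Fintype V] {h : SimpleGraph V} {S : Finset V}
    (hh : IsTwoFactorOn h S) (x q r aS aO : ℝ) (hx : 0 ≤ x) (hq : 0 ≤ q) (hr : 0 ≤ r)
    (haS : 0 ≤ aS) (haO : 0 ≤ aO)
    (h1 : 1 + 2 * x * r ≤ aS)
    (h2 : 1 + x * r + q * (S.card * aS + Sᶜ.card * aO) ≤ r)
    (h3 : 1 + q * (S.card * aS + Sᶜ.card * aO) ≤ aO) (M : ℕ) (p v : V) :
    ∑ l ∈ LL V M, (if Valid h S p v l then W h x q (edgesL v l) else 0)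
      ≤ Phi h S r aS aO p v := by
  induction M generalizing p v with
  | zero =>
    simp [LL, Phi]; split_ifs <;> assumption
  | succ M ih =>
    rw [sum_LL]
    refine le_trans ?_ (step_sum hh x q r aS aO hx hq hr haS haO h1 h2 h3 p v)
    apply add_le_add
    · simp [Valid, W, edgesL]
    · apply Finset.sum_le_sum
      intro w _
      by_cases hA : Allowed h S p v w
      · rw [if_pos hA]
        have h5 : 0 ≤ ew h x q s(v, w) := by unfold ew; split_ifs <;> assumption
        refine le_trans (le_of_eq ?_) (mul_le_mul_of_nonneg_left (ih v w) h5)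
        rw [Finset.mul_sum]
        apply Finset.sum_congr rfl
        intro l _
        by_cases hV : Valid h S v w l <;> simp [Valid, hA, hV, W, edgesL]
      · simp [Valid, hA]

def Op {V : Type*} (h : SimpleGraph V) (ω : Slot h → Bool) (e : Sym2 V) : Prop :=
  e ∈ h.edgeSet ∨ ∃ hm : ¬ e.IsDiag ∧ e ∉ h.edgeSet, ω ⟨e, hm⟩ = true

lemma W_scale {V : Type*} (h : SimpleGraph V) (x y p : ℝ) (E : List (Sym2 V)) :
    p ^ (E.filter (fun e => e ∉ h.edgeSet)).length * W h x y E = W h x (y * p) E := by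
  induction E with
  | nil => simp [W]
  | cons e E ih =>
    simp only [W, List.map_cons, List.prod_cons] at ih ⊢
    rw [← ih]
    by_cases he : e ∈ h.edgeSet
    · simp [ew, he]; ring
    · simp [ew, he, pow_succ]; ring

noncomputable def pr {V : Type*} [Fintype V] (h : SimpleGraph V) (p : ℝ) (ω : Slot h → Bool) : ℝ :=
  ∏ e : Slot h, (if ω e = true then p else 1 - p)

lemma pr_nonneg {V : Type*} [Fintype V] (h : SimpleGraph V) (p : ℝ) (hp0 : 0 ≤ p) (hp1 : p ≤ 1)
    (ω : Slot h → Bool) : 0 ≤ pr h p ω := by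
  apply Finset.prod_nonneg
  intro e _
  split_ifs <;> linarith

lemma pr_sum {V : Type*} [Fintype V] (h : SimpleGraph V) (p : ℝ) :
    ∑ ω : Slot h → Bool, pr h p ω = 1 := by
  have := exp_open (ι := Slot h) p ∅
  simpa [pr] using this

lemma exp_walk {V : Type*} [Fintype V] (h : SimpleGraph V) (x y p : ℝ) (hx : 0 ≤ x) (hy : 0 ≤ y)
    (hp0 : 0 ≤ p) (hp1 : p ≤ 1) (E : List (Sym2 V)) (hE : E.Nodup) :
    ∑ ω : Slot h → Bool, pr h p ω * (if ∀ e ∈ E, Op h ω e then W h x y E else 0)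
      ≤ W h x (y * p) E := by
  by_cases hd : ∃ e ∈ E, e.IsDiag
  · obtain ⟨e, he, hd⟩ := hd
    refine le_trans (le_of_eq ?_) (W_nonneg h x (y*p) hx (by positivity) E)
    apply Finset.sum_eq_zero
    intro ω _
    rw [if_neg, mul_zero]
    intro hall
    rcases hall e he with h1 | ⟨hm, _⟩
    · exact h.not_isDiag_of_mem_edgeSet h1 hd
    · exact hm.1 hd
  · push Not at hd
    set B : Finset (Slot h) := Finset.univ.filter (fun e => e.1 ∈ E) with hB
    have h1 : ∀ ω : Slot h → Bool, (∀ e ∈ E, Op h ω e) ↔ ∀ e ∈ B, ω e = true := by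
      intro ω
      constructor
      · intro H e he
        rcases H e.1 (by simpa [hB] using he) with h2 | ⟨_, h2⟩
        · exact absurd h2 e.2.2
        · exact h2
      · intro H e he
        by_cases hee : e ∈ h.edgeSet
        · exact Or.inl hee
        · exact Or.inr ⟨⟨hd e he, hee⟩, H ⟨e, ⟨hd e he, hee⟩⟩ (by simp [hB, he])⟩
    have h2 : ∑ ω : Slot h → Bool, pr h p ω * (if ∀ e ∈ E, Op h ω e then W h x y E else 0)
        = p ^ B.card * W h x y E := by
      rw [← exp_open p B, Finset.sum_mul]
      apply Finset.sum_congr rfl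
      intro ω _
      simp only [h1, pr]
      split_ifs <;> simp
    rw [h2, ← W_scale]
    apply mul_le_mul_of_nonneg_right _ (W_nonneg h x y hx hy E)
    apply pow_le_pow_of_le_one hp0 hp1
    rw [← List.toFinset_card_of_nodup (hE.filter _), ← Finset.card_map (Function.Embedding.subtype _)]
    apply Finset.card_le_card
    intro e he
    simp only [List.mem_toFinset, List.mem_filter, decide_eq_true_eq] at he
    simp only [Finset.mem_map, Function.Embedding.subtype_apply]
    exact ⟨⟨e, hd e he.1, he.2⟩, by simp [hB, he.1], rfl⟩

lemma exists_pair {V : Type*} (A B : Finset V) (P : Prop) (hAB : Disjoint A B)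
    (hc : A.card = B.card ∨ (A.card = 2 ∧ B = ∅) ∨ (¬ P ∧ A = ∅ ∧ B.card = 2)) :
    ∃ τ : V → V, ∀ w, (w ∈ A ∨ w ∈ B) → (τ w ∈ A ∨ τ w ∈ B) ∧ τ (τ w) = w ∧ τ w ≠ w ∧
      (P → w ∈ B → τ w ∈ A) := by
  have swp : ∀ (C : Finset V), C.card = 2 → ∃ τ : V → V, ∀ w ∈ C, τ w ∈ C ∧ τ (τ w) = w ∧ τ w ≠ w := by
    intro C hC
    obtain ⟨a, b, hab, rfl⟩ := Finset.card_eq_two.mp hC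
    refine ⟨Equiv.swap a b, ?_⟩
    intro w hw
    simp only [Finset.mem_insert, Finset.mem_singleton] at hw
    rcases hw with rfl | rfl
    · simp [hab.symm]
    · simp [hab]
  rcases hc with hc | ⟨hc, rfl⟩ | ⟨hP, rfl, hc⟩
  · let e : A ≃ B := Finset.equivOfCardEq hc
    have hA : ∀ w ∈ A, w ∉ B := fun w h1 h2 => Finset.disjoint_left.mp hAB h1 h2
    let τ : V → V := fun w => if h : w ∈ A then e ⟨w, h⟩ else if h : w ∈ B then e.symm ⟨w, h⟩ else w
    have t1 : ∀ w (h : w ∈ A), τ w = e ⟨w, h⟩ := fun w h => by simp [τ, h]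
    have t2 : ∀ w (h : w ∈ B), τ w = e.symm ⟨w, h⟩ := fun w h => by
      have : w ∉ A := fun h' => hA w h' h
      simp [τ, h, this]
    refine ⟨τ, ?_⟩
    rintro w (hw | hw)
    · have h1 := t1 w hw
      have h2 : τ w ∈ B := by rw [h1]; exact (e ⟨w, hw⟩).2
      refine ⟨Or.inr h2, ?_, ?_, fun _ hwB => absurd hwB (hA w hw)⟩
      · rw [t2 _ h2]
        have : (⟨τ w, h2⟩ : B) = e ⟨w, hw⟩ := Subtype.ext h1
        rw [this]; simp
      · intro h; rw [h] at h2; exact hA w hw h2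
    · have h1 := t2 w hw
      have h2 : τ w ∈ A := by rw [h1]; exact (e.symm ⟨w, hw⟩).2
      refine ⟨Or.inl h2, ?_, ?_, fun _ _ => h2⟩
      · rw [t1 _ h2]
        have : (⟨τ w, h2⟩ : A) = e.symm ⟨w, hw⟩ := Subtype.ext h1
        rw [this]; simp
      · intro h; rw [h] at h2; exact hA w h2 hw
  · obtain ⟨τ, hτ⟩ := swp A hc
    exact ⟨τ, by simpa using hτ⟩
  · obtain ⟨τ, hτ⟩ := swp B hc
    exact ⟨τ, by simpa [hP] using hτ⟩

def mkPerm {V : Type*} (G : SimpleGraph V) (τ : V → V → V)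
    (h1 : ∀ v w, G.Adj v w → G.Adj v (τ v w)) (h2 : ∀ v w, G.Adj v w → τ v (τ v w) = w) :
    Equiv.Perm G.Dart where
  toFun d := ⟨(d.snd, τ d.snd d.fst), h1 _ _ d.adj.symm⟩
  invFun d := ⟨(τ d.fst d.snd, d.fst), (h1 _ _ d.adj).symm⟩
  left_inv d := by
    apply SimpleGraph.Dart.ext
    exact Prod.ext (h2 _ _ d.adj.symm) rfl
  right_inv d := by
    apply SimpleGraph.Dart.ext
    exact Prod.ext rfl (h2 _ _ d.adj)

lemma no_rev {V : Type*} (G : SimpleGraph V) (τ : V → V → V)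
    (h1 : ∀ v w, G.Adj v w → G.Adj v (τ v w)) (h2 : ∀ v w, G.Adj v w → τ v (τ v w) = w)
    (h3 : ∀ v w, G.Adj v w → τ v w ≠ w) (k : ℕ) (d : G.Dart) :
    ((mkPerm G τ h1 h2) ^ k) d ≠ d.symm := by
  induction k using Nat.strong_induction_on generalizing d with
  | _ k ih =>
    match k, ih with
    | 0, _ => exact (SimpleGraph.Dart.symm_ne d).symm
    | 1, _ =>
      intro h
      have : τ d.snd d.fst = d.fst := congrArg (fun d : G.Dart => d.snd) h
      exact h3 _ _ d.adj.symm this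
    | k+2, ih =>
      intro h
      have e1 : mkPerm G τ h1 h2 ((mkPerm G τ h1 h2 d).symm) = d.symm := by
        apply SimpleGraph.Dart.ext
        exact Prod.ext rfl (h2 _ _ d.adj.symm)
      rw [← e1, pow_succ', Equiv.Perm.mul_apply] at h
      have h' := (mkPerm G τ h1 h2).injective h
      rw [pow_succ, Equiv.Perm.mul_apply] at h'
      exact ih k (by omega) _ h'

lemma cyc_sum {X : Type*} [Fintype X] (σ : Equiv.Perm X) (g F : X → ℝ) (blue : X → Prop)
    (hneg : ∀ d, ¬ blue d → g d ≤ 0) (hF0 : ∀ d, 0 ≤ F d)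
    (hF : ∀ d, blue d → ∑ d' ∈ Finset.univ.filter (fun d' => σ.SameCycle d d'), g d' ≤ F d) :
    ∑ d, g d ≤ ∑ d ∈ Finset.univ.filter blue, F d := by
  let s := Equiv.Perm.SameCycle.setoid σ
  rw [Finset.sum_filter]
  rw [← Finset.sum_fiberwise (s := Finset.univ) (g := fun d => (Quotient.mk s d)) (f := g),
    ← Finset.sum_fiberwise (s := Finset.univ) (g := fun d => (Quotient.mk s d))
      (f := fun d => if blue d then F d else 0)]
  apply Finset.sum_le_sum
  intro q _
  by_cases hq : ∃ d, Quotient.mk s d = q ∧ blue d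
  · obtain ⟨d, hd, hb⟩ := hq
    have e1 : Finset.univ.filter (fun d' => Quotient.mk s d' = q)
        = Finset.univ.filter (fun d' => σ.SameCycle d d') := by
      ext d'
      simp only [Finset.mem_filter, Finset.mem_univ, true_and]
      rw [← hd, eq_comm, Quotient.eq]
      rfl
    calc _ ≤ F d := by rw [e1]; exact hF d hb
      _ = (if blue d then F d else 0) := by rw [if_pos hb]
      _ ≤ _ := by
        apply Finset.single_le_sum (f := fun d => if blue d then F d else 0)
        · intro i _
          split_ifs
          · exact hF0 i
          · exact le_rfl
        · simp [hd]
  · push Not at hq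
    calc _ ≤ (0:ℝ) := Finset.sum_nonpos (fun d hd => hneg d (hq d (by simpa using hd)))
      _ ≤ _ := by
        apply Finset.sum_nonneg
        intro i _
        split_ifs
        · exact hF0 i
        · exact le_rfl

section walk
variable {V : Type*} {G : SimpleGraph V} (σ : Equiv.Perm G.Dart)
    (hσ : ∀ d, (σ d).fst = d.snd)

def lst (d : G.Dart) (k : ℕ) : List V := (List.iterate σ (σ d) k).map (fun d => d.snd)

lemma edges_lst (hσ : ∀ d, (σ d).fst = d.snd) (d : G.Dart) (k : ℕ) :
    edgesL d.snd (lst σ d k) = (List.iterate σ (σ d) k).map (fun d => d.edge) := by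
  induction k generalizing d with
  | zero => simp [lst, edgesL]
  | succ k ih =>
    have := ih (σ d)
    simp only [lst, List.iterate, List.map_cons, edgesL] at this ⊢
    rw [this, ← hσ d]
    rfl

lemma valid_lst (h : SimpleGraph V) (S : Finset V) (hσ : ∀ d, (σ d).fst = d.snd)
    (hA : ∀ d : G.Dart, Allowed h S d.fst d.snd (σ d).snd) (d : G.Dart) (k : ℕ) :
    Valid h S d.fst d.snd (lst σ d k) := by
  induction k generalizing d with
  | zero => simp [lst, Valid]
  | succ k ih =>
    have := ih (σ d)
    simp only [lst, List.iterate, List.map_cons, Valid] at this ⊢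
    refine ⟨hA d, ?_⟩
    rw [← hσ d]; exact this

lemma last_lst (d : G.Dart) (k : ℕ) :
    (lst σ d k).getLastD d.snd = (σ^[k] d).snd := by
  induction k generalizing d with
  | zero => simp [lst]
  | succ k ih =>
    have := ih (σ d)
    simp only [lst, List.iterate, List.map_cons] at this ⊢
    rw [List.getLastD_cons, this]
    rfl

end walk

lemma valid_blue {V : Type*} (h : SimpleGraph V) (S : Finset V) (p v : V) (l : List V)
    (hb : ¬ h.Adj p v) (hv : Valid h S p v l) : Valid h S v v l := by
  cases l with
  | nil => trivial
  | cons w l =>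
    refine ⟨⟨fun h' => absurd h' (h.irrefl), fun _ => hv.1.2 hb⟩, hv.2⟩

lemma filt_add {X : Type*} [Fintype X] (P Q : X → Prop) :
    (Finset.univ.filter (fun w => P w ∧ ¬ Q w)).card + (Finset.univ.filter (fun w => P w ∧ Q w)).card
      = (Finset.univ.filter P).card := by
  rw [← Finset.card_filter_add_card_filter_not (s := Finset.univ.filter P) Q, Finset.filter_filter,
    Finset.filter_filter, add_comm]

lemma pair_card {V : Type*} [Fintype V] {h : SimpleGraph V} {S : Finset V}
    (hh : IsTwoFactorOn h S) :
    (Finset.univ.filter (fun p : V × V => h.Adj p.1 p.2)).card = 2 * S.card := by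
  rw [Finset.card_filter, Fintype.sum_prod_type]
  have : ∀ v : V, (∑ w : V, if h.Adj v w then 1 else 0) = if v ∈ S then 2 else 0 := by
    intro v
    rw [← adj_card hh v, Finset.card_filter]
  simp only [this]
  simp [mul_comm]

def DG {V : Type*} (h H : SimpleGraph V) : SimpleGraph V := (h \ H) ⊔ (H \ h)

lemma DG_adj {V : Type*} (h H : SimpleGraph V) (u v : V) :
    (DG h H).Adj u v ↔ (h.Adj u v ∧ ¬ H.Adj u v) ∨ (H.Adj u v ∧ ¬ h.Adj u v) := by
  simp [DG]

lemma dart_pair {V : Type*} [Fintype V] (G : SimpleGraph V) (P : V → V → Prop) :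
    (Finset.univ.filter (fun d : G.Dart => P d.fst d.snd)).card
      = (Finset.univ.filter (fun p : V × V => G.Adj p.1 p.2 ∧ P p.1 p.2)).card := by
  apply Finset.card_bij (fun d _ => d.toProd)
  · intro d hd
    simp only [Finset.mem_filter, Finset.mem_univ, true_and] at hd ⊢
    exact ⟨d.adj, hd⟩
  · intro d _ d' _ h
    exact SimpleGraph.Dart.ext _ _ h
  · intro p hp
    simp only [Finset.mem_filter, Finset.mem_univ, true_and] at hp
    exact ⟨⟨p, hp.1⟩, by simpa using hp.2, rfl⟩

lemma dart_counts {V : Type*} [Fintype V] {h H : SimpleGraph V} {S T : Finset V}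
    (hh : IsTwoFactorOn h S) (hH : IsTwoFactorOn H T) (hST : S.card = T.card) :
    (Finset.univ.filter (fun d : (DG h H).Dart => ¬ h.Adj d.fst d.snd)).card
      = (symmDiff h.edgeFinset H.edgeFinset).card ∧
    (Finset.univ.filter (fun d : (DG h H).Dart => h.Adj d.fst d.snd)).card
      = (symmDiff h.edgeFinset H.edgeFinset).card := by
  have e0 : symmDiff h.edgeFinset H.edgeFinset = (DG h H).edgeFinset := by
    ext e
    induction e with
    | _ u v =>
      simp only [Finset.mem_symmDiff, SimpleGraph.mem_edgeFinset, SimpleGraph.mem_edgeSet, DG_adj]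
  have e1 := (DG h H).dart_card_eq_twice_card_edges
  have e2 := Finset.card_filter_add_card_filter_not (s := (Finset.univ : Finset (DG h H).Dart))
    (fun d => h.Adj d.fst d.snd)
  have e3 := dart_pair (DG h H) (fun u v => h.Adj u v)
  have e5 := filt_add (fun p : V × V => h.Adj p.1 p.2) (fun p => H.Adj p.1 p.2)
  have e6 := filt_add (fun p : V × V => H.Adj p.1 p.2) (fun p => h.Adj p.1 p.2)
  rw [pair_card hh] at e5
  rw [pair_card hH] at e6
  have e7 : (Finset.univ.filter (fun p : V × V => (DG h H).Adj p.1 p.2 ∧ h.Adj p.1 p.2))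
    = Finset.univ.filter (fun p : V × V => h.Adj p.1 p.2 ∧ ¬ H.Adj p.1 p.2) := by
    ext p; simp only [Finset.mem_filter, Finset.mem_univ, true_and, DG_adj]; tauto
  have e8 : (Finset.univ.filter (fun p : V × V => (DG h H).Adj p.1 p.2 ∧ ¬ h.Adj p.1 p.2))
    = Finset.univ.filter (fun p : V × V => H.Adj p.1 p.2 ∧ ¬ h.Adj p.1 p.2) := by
    ext p; simp only [Finset.mem_filter, Finset.mem_univ, true_and, DG_adj]; tauto
  have e9 : (Finset.univ.filter (fun p : V × V => H.Adj p.1 p.2 ∧ h.Adj p.1 p.2))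
    = Finset.univ.filter (fun p : V × V => h.Adj p.1 p.2 ∧ H.Adj p.1 p.2) := by
    ext p; simp only [Finset.mem_filter, Finset.mem_univ, true_and]; tauto
  rw [e7] at e3
  have e4 : (Finset.univ.filter (fun d : (DG h H).Dart => ¬ h.Adj d.fst d.snd)).card
      = (Finset.univ.filter (fun p : V × V => H.Adj p.1 p.2 ∧ ¬ h.Adj p.1 p.2)).card := by
    rw [← e8]
    convert dart_pair (DG h H) (fun u v => ¬ h.Adj u v)
  rw [e9] at e6
  rw [e0]
  rw [Finset.card_univ] at e2
  constructor <;> omega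

lemma exists_tau {V : Type*} [Fintype V] {h H : SimpleGraph V} {S T : Finset V}
    (hh : IsTwoFactorOn h S) (hH : IsTwoFactorOn H T) :
    ∃ τ : V → V → V, ∀ v w, (DG h H).Adj v w → (DG h H).Adj v (τ v w) ∧ τ v (τ v w) = w ∧
      τ v w ≠ w ∧ (v ∈ S → ¬ h.Adj v w → h.Adj v (τ v w)) := by
  have : ∀ v, ∃ τ : V → V, ∀ w, (DG h H).Adj v w → (DG h H).Adj v (τ w) ∧ τ (τ w) = w ∧
      τ w ≠ w ∧ (v ∈ S → ¬ h.Adj v w → h.Adj v (τ w)) := by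
    intro v
    have e5 := filt_add (fun w : V => h.Adj v w) (fun w => H.Adj v w)
    have e6 := filt_add (fun w : V => H.Adj v w) (fun w => h.Adj v w)
    rw [adj_card hh] at e5
    rw [adj_card hH] at e6
    have e9 : (Finset.univ.filter (fun w : V => H.Adj v w ∧ h.Adj v w))
      = Finset.univ.filter (fun w : V => h.Adj v w ∧ H.Adj v w) := by
      ext p; simp only [Finset.mem_filter, Finset.mem_univ, true_and]; tauto
    rw [e9] at e6
    obtain ⟨τ, hτ⟩ := exists_pair (Finset.univ.filter (fun w : V => h.Adj v w ∧ ¬ H.Adj v w))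
      (Finset.univ.filter (fun w : V => H.Adj v w ∧ ¬ h.Adj v w)) (v ∈ S)
      (by
        rw [Finset.disjoint_left]
        intro w h1 h2
        simp only [Finset.mem_filter, Finset.mem_univ, true_and] at h1 h2
        exact h2.2 h1.1)
      (by
        rw [← Finset.card_eq_zero, ← Finset.card_eq_zero]
        by_cases h1 : v ∈ S <;> by_cases h2 : v ∈ T <;> simp only [h1, h2, if_true, if_false] at e5 e6 <;>
          simp only [h1, not_true, not_false_eq_true, false_and, true_and] <;> omega)
    refine ⟨τ, ?_⟩
    intro w hw
    have := hτ w (by simpa only [Finset.mem_filter, Finset.mem_univ, true_and, DG_adj] using hw)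
    simp only [Finset.mem_filter, Finset.mem_univ, true_and] at this
    rw [DG_adj] at hw ⊢
    refine ⟨this.1, this.2.1, this.2.2.1, ?_⟩
    intro h1 h2
    exact (this.2.2.2 h1 (by tauto)).1
  choose τ hτ using this
  exact ⟨τ, hτ⟩

def Good {V : Type*} (h : SimpleGraph V) (S : Finset V) (ω : Slot h → Bool) (v : V) (l : List V) :
    Prop :=
  Valid h S v v l ∧ s(l.getLastD v, v) ∉ h.edgeSet ∧ (s(l.getLastD v, v) :: edgesL v l).Nodup ∧
    ∀ e ∈ s(l.getLastD v, v) :: edgesL v l, Op h ω e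

lemma det {V : Type*} [Fintype V] {h H : SimpleGraph V} {S T : Finset V}
    (hh : IsTwoFactorOn h S) (hH : IsTwoFactorOn H T) (hST : S.card = T.card)
    (ω : Slot h → Bool) (hop : ∀ e ∈ H.edgeSet, Op h ω e) (x z : ℝ) (hx : 0 < x) (hx1 : x < 1)
    (hz : 1 < z) :
    ((symmDiff h.edgeFinset H.edgeFinset).card : ℝ) ≤ 1 / Real.log z *
      ∑ a ∈ (Finset.univ : Finset V) ×ˢ LL V (Fintype.card (V × V) + 1),
        (if Good h S ω a.1 a.2 then W h x (z/x) (s(a.2.getLastD a.1, a.1) :: edgesL a.1 a.2) else 0) := by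
  obtain ⟨τ, hτ⟩ := exists_tau hh hH
  set η := Real.log z with hη
  have hη0 : 0 < η := Real.log_pos hz
  set K := - Real.log x / η with hK
  have hK0 : 0 ≤ K := div_nonneg (by have := Real.log_neg hx hx1; linarith) hη0.le
  let σ := mkPerm (DG h H) τ (fun v w hw => (hτ v w hw).1) (fun v w hw => (hτ v w hw).2.1)
  have hσ : ∀ d, (σ d).fst = d.snd := fun d => rfl
  have hσ2 : ∀ d, (σ d).snd = τ d.snd d.fst := fun d => rfl
  have hrev : ∀ (k : ℕ) d, (σ ^ k) d ≠ d.symm :=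
    no_rev (DG h H) τ _ _ (fun v w hw => (hτ v w hw).2.2.1)
  have hsup : ∀ d, d ∈ σ.support := by
    intro d
    rw [Equiv.Perm.mem_support]
    intro hd
    have : (σ d).fst = d.fst := by rw [hd]
    rw [hσ] at this
    exact d.adj.ne this.symm
  have hA : ∀ d : (DG h H).Dart, Allowed h S d.fst d.snd (σ d).snd := by
    intro d
    have := hτ d.snd d.fst d.adj.symm
    rw [hσ2]
    refine ⟨fun _ => this.2.2.1, fun h1 h2 => this.2.2.2 h2 (fun h3 => h1 h3.symm)⟩
  let blue : (DG h H).Dart → Prop := fun d => ¬ h.Adj d.fst d.snd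
  let g : (DG h H).Dart → ℝ := fun d => if h.Adj d.fst d.snd then -K else 1 + K
  have hexp : ∀ d, Real.exp (η * g d) = ew h x (z/x) d.edge := by
    intro d
    have e1 : d.edge ∈ h.edgeSet ↔ h.Adj d.fst d.snd := Iff.rfl
    simp only [ew, g, e1]
    have e2 : η * K = - Real.log x := by rw [hK]; field_simp
    split_ifs
    · rw [mul_neg, e2, neg_neg, Real.exp_log hx]
    · rw [mul_add, mul_one, e2, Real.exp_add, Real.exp_neg, Real.exp_log hx, hη,
        Real.exp_log (by linarith)]
      rfl
  let L : (DG h H).Dart → List (DG h H).Dart := fun d => σ.toList d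
  let kk : (DG h H).Dart → ℕ := fun d => (L d).length - 1
  have hL : ∀ d, L d = d :: List.iterate σ (σ d) (kk d) := by
    intro d
    have h1 : 0 < (L d).length := Equiv.Perm.length_toList_pos_of_mem_support _ _ (hsup d)
    have h2 : L d = List.iterate σ d (L d).length := by
      simp only [L, Equiv.Perm.length_toList]; rfl
    have h3 : (L d).length = kk d + 1 := by simp only [kk]; omega
    rw [h2, h3]
    rfl
  have hper : ∀ d, σ^[kk d + 1] d = d := by
    intro d
    have h1 : 0 < (L d).length := Equiv.Perm.length_toList_pos_of_mem_support _ _ (hsup d)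
    have h3 : kk d + 1 = (σ.cycleOf d).support.card := by
      rw [← Equiv.Perm.length_toList]; simp only [kk, L] at h1 ⊢; omega
    rw [h3]
    have := Equiv.Perm.pow_mod_card_support_cycleOf_self_apply σ (σ.cycleOf d).support.card d
    rw [Nat.mod_self] at this
    rw [← Equiv.Perm.iterate_eq_pow] at this
    rw [← Equiv.Perm.iterate_eq_pow] at this
    exact this.symm
  have hlast : ∀ d, (lst σ d (kk d)).getLastD d.snd = d.fst := by
    intro d
    rw [last_lst, ← hσ, ← Function.iterate_succ_apply' σ, hper]
  have hE : ∀ d, s((lst σ d (kk d)).getLastD d.snd, d.snd) :: edgesL d.snd (lst σ d (kk d))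
      = (L d).map (fun d => d.edge) := by
    intro d
    rw [hlast, edges_lst σ hσ, hL, List.map_cons]
    rfl
  have hmem : ∀ d d', d' ∈ L d ↔ σ.SameCycle d d' := by
    intro d d'
    simp only [L]
    rw [Equiv.Perm.mem_toList_iff]
    simp [hsup d]
  have hnd : ∀ d, ((L d).map (fun d => d.edge)).Nodup := by
    intro d
    apply List.Nodup.map_on _ (Equiv.Perm.nodup_toList σ d)
    intro d1 h1 d2 h2 he
    rcases (SimpleGraph.dart_edge_eq_iff d1 d2).mp he with h3 | h3
    · exact h3
    · exfalso
      have h4 : σ.SameCycle d2 d1 := ((hmem d d2).mp h2).symm.trans ((hmem d d1).mp h1)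
      obtain ⟨i, _, hi⟩ := h4.exists_pow_eq'
      exact hrev i d2 (hi.trans h3)
  let F : (DG h H).Dart → ℝ := fun d => 1 / η * W h x (z/x) ((L d).map (fun d => d.edge))
  have hzx : 0 ≤ z / x := by positivity
  have hF0 : ∀ d, 0 ≤ F d := fun d =>
    mul_nonneg (by positivity) (W_nonneg h x (z/x) hx.le hzx _)
  have key := cyc_sum σ g F blue
    (by
      intro d hd
      simp only [blue, not_not] at hd
      simp only [g, hd, if_true]; linarith)
    hF0
    (by
      intro d _
      refine (Finset.sum_congr (s₂ := (L d).toFinset) (by ext d'; simp [hmem])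
        (fun _ _ => rfl)).trans_le ?_
      have h2 : W h x (z/x) ((L d).map (fun d => d.edge))
          = Real.exp (η * ∑ d' ∈ (L d).toFinset, g d') := by
        rw [Finset.mul_sum, Real.exp_sum, List.prod_toFinset _ (Equiv.Perm.nodup_toList σ d)]
        simp only [hexp, W, List.map_map]
        rfl
      simp only [F]
      rw [h2, one_div, inv_mul_eq_div, le_div_iff₀ hη0]
      have := Real.add_one_le_exp (η * ∑ d' ∈ (L d).toFinset, g d')
      linarith)
  obtain ⟨c1, c2⟩ := dart_counts hh hH hST
  have hsum : ∑ d, g d = ((symmDiff h.edgeFinset H.edgeFinset).card : ℝ) := by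
    simp only [g]
    rw [Finset.sum_ite, Finset.sum_const, Finset.sum_const, c1, c2]
    simp only [nsmul_eq_mul]
    ring
  rw [hsum] at key
  refine key.trans ?_
  rw [← Finset.mul_sum]
  apply mul_le_mul_of_nonneg_left _ (by positivity)
  let ι : (DG h H).Dart → V × List V := fun d => (d.snd, lst σ d (kk d))
  have hinj : Function.Injective ι := by
    intro d d' hdd
    have h1 : d.snd = d'.snd := congrArg Prod.fst hdd
    have h2 : lst σ d (kk d) = lst σ d' (kk d') := congrArg Prod.snd hdd
    have h3 : d.fst = d'.fst := by rw [← hlast d, ← hlast d', h1, h2]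
    exact SimpleGraph.Dart.ext _ _ (Prod.ext h3 h1)
  have hstep : ∑ d ∈ Finset.univ.filter blue, W h x (z/x) ((L d).map (fun d => d.edge))
      = ∑ a ∈ (Finset.univ.filter blue).image ι,
        (if Good h S ω a.1 a.2 then W h x (z/x) (s(a.2.getLastD a.1, a.1) :: edgesL a.1 a.2) else 0) := by
    rw [Finset.sum_image (fun _ _ _ _ hab => hinj hab)]
    apply Finset.sum_congr rfl
    intro d hd
    have hb : ¬ h.Adj d.fst d.snd := by simpa [blue] using hd
    rw [if_pos, hE]
    refine ⟨valid_blue h S d.fst d.snd _ hb (valid_lst σ h S hσ hA d _), ?_, ?_, ?_⟩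
    · simp only [ι]; rw [hlast]; exact hb
    · rw [hE]; exact hnd d
    · rw [hE]
      intro e he
      obtain ⟨d', _, rfl⟩ := List.mem_map.mp he
      rcases (DG_adj h H _ _).mp d'.adj with h1 | h1
      · exact Or.inl h1.1
      · exact hop _ h1.1
  refine le_trans (le_of_eq ?_) (hstep.trans_le ?_)
  · congr
  apply Finset.sum_le_sum_of_subset_of_nonneg
  · intro a ha
    obtain ⟨d, _, rfl⟩ := Finset.mem_image.mp ha
    simp only [ι, Finset.mem_product, Finset.mem_univ, true_and, mem_LL]
    simp only [lst, List.length_map, List.length_iterate]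
    have h1 : (L d).length ≤ Fintype.card (DG h H).Dart :=
      List.Nodup.length_le_card (Equiv.Perm.nodup_toList σ d)
    have h2 : Fintype.card (DG h H).Dart ≤ Fintype.card (V × V) :=
      Fintype.card_le_of_injective (fun d => d.toProd) (fun d d' hd => SimpleGraph.Dart.ext _ _ hd)
    simp only [kk]
    omega
  · intro a _ _
    split_ifs
    · exact W_nonneg h x (z/x) hx.le hzx _
    · exact le_rfl

lemma expected {V : Type*} [Fintype V] {h : SimpleGraph V} {S : Finset V}
    (hh : IsTwoFactorOn h S) (x z p r aS aO : ℝ) (hx : 0 < x) (hz : 0 ≤ z) (hp0 : 0 ≤ p)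
    (hp1 : p ≤ 1) (hr : 0 ≤ r) (haS : 0 ≤ aS) (haO : 0 ≤ aO)
    (h1 : 1 + 2 * x * r ≤ aS)
    (h2 : 1 + x * r + (z/x*p) * (S.card * aS + Sᶜ.card * aO) ≤ r)
    (h3 : 1 + (z/x*p) * (S.card * aS + Sᶜ.card * aO) ≤ aO) (M : ℕ) :
    ∑ ω : Slot h → Bool, pr h p ω * ∑ a ∈ (Finset.univ : Finset V) ×ˢ LL V M,
        (if Good h S ω a.1 a.2 then W h x (z/x) (s(a.2.getLastD a.1, a.1) :: edgesL a.1 a.2) else 0)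
      ≤ Fintype.card V * ((z/x*p) * (aS + aO)) := by
  have hzx : 0 ≤ z / x := by positivity
  have hq : 0 ≤ z / x * p := by positivity
  simp_rw [Finset.mul_sum]
  rw [Finset.sum_comm, Finset.sum_product]
  have key : ∀ v l, ∑ ω : Slot h → Bool, pr h p ω *
      (if Good h S ω v l then W h x (z/x) (s(l.getLastD v, v) :: edgesL v l) else 0)
      ≤ (z/x*p) * (if Valid h S v v l then W h x (z/x*p) (edgesL v l) else 0) := by
    intro v l
    by_cases hg : Valid h S v v l ∧ s(l.getLastD v, v) ∉ h.edgeSet ∧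
        (s(l.getLastD v, v) :: edgesL v l).Nodup
    · obtain ⟨g1, g2, g3⟩ := hg
      have := exp_walk h x (z/x) p hx.le hzx hp0 hp1 _ g3
      have e2 : W h x (z/x*p) (s(l.getLastD v, v) :: edgesL v l)
          = (z/x*p) * W h x (z/x*p) (edgesL v l) := by
        simp only [W, List.map_cons, List.prod_cons]
        congr 1
        simp only [ew, g2, if_false]
      rw [if_pos g1, ← e2]
      refine le_trans (le_of_eq ?_) this
      apply Finset.sum_congr rfl
      intro ω _
      have : Good h S ω v l ↔ ∀ e ∈ s(l.getLastD v, v) :: edgesL v l, Op h ω e :=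
        ⟨fun hG => hG.2.2.2, fun hG => ⟨g1, g2, g3, hG⟩⟩
      simp only [this]
    · have : ∀ ω, ¬ Good h S ω v l := fun ω hG => hg ⟨hG.1, hG.2.1, hG.2.2.1⟩
      simp only [this, if_false, mul_zero, Finset.sum_const_zero]
      apply mul_nonneg hq
      split_ifs
      · exact W_nonneg h x _ hx.le hq _
      · exact le_rfl
  calc _ ≤ ∑ v : V, ∑ l ∈ LL V M,
        (z/x*p) * (if Valid h S v v l then W h x (z/x*p) (edgesL v l) else 0) :=
        Finset.sum_le_sum (fun v _ => Finset.sum_le_sum (fun l _ => key v l))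
    _ ≤ ∑ v : V, (z/x*p) * (aS + aO) := by
        apply Finset.sum_le_sum
        intro v _
        rw [← Finset.mul_sum]
        apply mul_le_mul_of_nonneg_left _ hq
        refine (walk_sum hh x (z/x*p) r aS aO hx.le hq hr haS haO h1 h2 h3 M v v).trans ?_
        simp only [Phi, h.irrefl, if_false]
        split_ifs <;> linarith
    _ = _ := by simp

end PC

open scoped Classical in
/-- for `δ ∈ (0,1]` and `0 < λ < 1/(√(2δ)+√(1−δ))²` there is a constant `C`
such that for every `n ≥ λ`, every `S ⊆ Fin n` of size `⌊δn⌋`, and every 2-factor `h` on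
`S`, in the conditional planted model the expected value of the maximum, over all
2-factors `H` on some size-`⌊δn⌋` vertex subset all of whose edges lie in the realized
graph, of `|edges(h) Δ edges(H)|`, is at most `C`. The expectation is an explicit sum over
outcomes `ω : Slot h → Bool` with product Bernoulli weights, and the maximum is `sSup` of
the (nonempty, finite) set of attained symmetric-difference sizes. -/
theorem stmt9 (δ : ℝ) (hδ0 : 0 < δ) (hδ1 : δ ≤ 1) (lam : ℝ) (hlam0 : 0 < lam)
    (hlam : lam < 1 / (Real.sqrt (2*δ) + Real.sqrt (1-δ))^2) :
    ∃ C : ℝ, ∀ n : ℕ, lam ≤ n →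
      ∀ S : Finset (Fin n), S.card = ⌊δ * n⌋₊ →
      ∀ h : SimpleGraph (Fin n), IsTwoFactorOn h S →
      ∑ ω : Slot h → Bool,
        (∏ e : Slot h, (if ω e then lam/n else 1 - lam/n)) *
          ((sSup {k : ℕ | ∃ H : SimpleGraph (Fin n),
              (∃ T : Finset (Fin n), T.card = ⌊δ * n⌋₊ ∧ IsTwoFactorOn H T) ∧
              (∀ e ∈ H.edgeSet, e ∈ h.edgeSet ∨
                ∃ hm : ¬ e.IsDiag ∧ e ∉ h.edgeSet, ω ⟨e, hm⟩ = true) ∧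
              k = (symmDiff h.edgeFinset H.edgeFinset).card} : ℕ) : ℝ)
        ≤ C := by

  classical
  obtain ⟨x, z, n0, hx0, hx1, hz, hn0, hθ⟩ := PC.params2 δ hδ0 hδ1 lam hlam0 hlam
  have hx1' : 0 < 1 - x := by linarith
  have hn0' : (0:ℝ) < n0 := by exact_mod_cast hn0
  set o : ℝ := 1 - δ + 1 / n0 with ho
  have ho0 : 0 < o := by
    have : (0:ℝ) < 1 / n0 := by positivity
    linarith
  set q' : ℝ := z / x * lam with hq'
  have hq'0 : 0 < q' := by positivity
  set θ : ℝ := z * lam * (2 * δ / (1 - x) + o / x) with hθd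
  set B : ℝ := (δ * (1 + 2 * x / (1 - x)) + o) / (1 - θ) with hB
  have hB0 : 0 < B := by
    have : 0 < 1 - θ := by linarith
    positivity
  set r : ℝ := (1 + q' * B) / (1 - x) with hr
  have hr0 : 0 < r := by positivity
  set aS : ℝ := 1 + 2 * x * r with haS
  set aO : ℝ := 1 + q' * B with haO
  have haS0 : 0 < aS := by positivity
  have haO0 : 0 < aO := by positivity
  have hr1 : r * (1 - x) = 1 + q' * B := by rw [hr, div_mul_cancel₀ _ hx1'.ne']
  have hBeq : δ * aS + o * aO = B := by
    have h1 : B * (1 - θ) = δ * (1 + 2 * x / (1 - x)) + o := by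
      rw [hB, div_mul_cancel₀]; linarith
    have h2 : θ = q' * (2 * x * δ / (1 - x) + o) := by
      rw [hθd, hq']; field_simp
    have h3 : δ * aS + o * aO = δ * (1 + 2 * x / (1 - x)) + o + q' * (2 * x * δ / (1 - x) + o) * B := by
      rw [haS, haO, hr]; field_simp; ring
    rw [h3, ← h2, ← h1]; ring
  obtain ⟨Nc, hNc⟩ : ∃ Nc : ℕ, Nc = (n0 + 1).choose 2 := ⟨_, rfl⟩
  set C1 : ℝ := 1 / Real.log z * (q' * (aS + aO)) with hC1
  have hlogz : 0 < Real.log z := Real.log_pos hz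
  have hC10 : 0 ≤ C1 := by positivity
  refine ⟨C1 + (Nc : ℝ), ?_⟩
  intro n hn S hS h hh
  have hn' : (0:ℝ) < n := lt_of_lt_of_le hlam0 hn
  have hp0 : 0 ≤ lam / n := by positivity
  have hp1 : lam / n ≤ 1 := by rw [div_le_one hn']; exact hn
  have hmem : ∀ ω : Slot h → Bool, ∃ H : SimpleGraph (Fin n), ∃ T : Finset (Fin n),
      T.card = S.card ∧ IsTwoFactorOn H T ∧ (∀ e ∈ H.edgeSet, PC.Op h ω e) ∧
      (sSup {k : ℕ | ∃ H : SimpleGraph (Fin n),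
              (∃ T : Finset (Fin n), T.card = ⌊δ * n⌋₊ ∧ IsTwoFactorOn H T) ∧
              (∀ e ∈ H.edgeSet, e ∈ h.edgeSet ∨
                ∃ hm : ¬ e.IsDiag ∧ e ∉ h.edgeSet, ω ⟨e, hm⟩ = true) ∧
              k = (symmDiff h.edgeFinset H.edgeFinset).card}) =
        (symmDiff h.edgeFinset H.edgeFinset).card := by
    intro ω
    have := Nat.sSup_mem (s := {k : ℕ | ∃ H : SimpleGraph (Fin n),
              (∃ T : Finset (Fin n), T.card = ⌊δ * n⌋₊ ∧ IsTwoFactorOn H T) ∧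
              (∀ e ∈ H.edgeSet, e ∈ h.edgeSet ∨
                ∃ hm : ¬ e.IsDiag ∧ e ∉ h.edgeSet, ω ⟨e, hm⟩ = true) ∧
              k = (symmDiff h.edgeFinset H.edgeFinset).card})
      ⟨_, h, ⟨S, hS, hh⟩, fun e he => Or.inl he, rfl⟩
      ⟨Fintype.card (Sym2 (Fin n)), by
        rintro k ⟨H, _, _, rfl⟩
        exact Finset.card_le_univ _⟩
    obtain ⟨H, ⟨T, hT, hHT⟩, hop, hk⟩ := this
    exact ⟨H, T, hT.trans hS.symm, hHT, hop, hk⟩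
  have hprn := PC.pr_nonneg h (lam/n) hp0 hp1
  have hprs := PC.pr_sum h (lam/n)
  by_cases hnn : n0 ≤ n
  · have hnn' : (n0:ℝ) ≤ n := by exact_mod_cast hnn
    have hScard : (S.card : ℝ) ≤ δ * n := by
      rw [hS]; exact Nat.floor_le (by positivity)
    have hSc : (Sᶜ.card : ℝ) ≤ o * n := by
      have h1 : (S.card : ℝ) + Sᶜ.card = n := by
        have := Finset.card_add_card_compl S
        rw [Fintype.card_fin] at this
        exact_mod_cast this
      have h2 : δ * n < S.card + 1 := by rw [hS]; exact Nat.lt_floor_add_one _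
      have h3 : 1 ≤ 1 / (n0:ℝ) * n := by
        rw [one_div, inv_mul_eq_div, le_div_iff₀ hn0']; linarith
      rw [ho]; nlinarith
    have hqq : z / x * (lam / n) = q' / n := by rw [hq']; ring
    have hmain : z / x * (lam / n) * (S.card * aS + Sᶜ.card * aO) ≤ q' * B := by
      have h1 : (S.card * aS + Sᶜ.card * aO) ≤ n * B := by
        rw [← hBeq]
        have := mul_le_mul_of_nonneg_right hScard haS0.le
        have := mul_le_mul_of_nonneg_right hSc haO0.le
        nlinarith
      rw [hqq]
      calc q' / n * (S.card * aS + Sᶜ.card * aO) ≤ q' / n * (n * B) :=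
            mul_le_mul_of_nonneg_left h1 (by positivity)
        _ = q' * B := by field_simp
    have hm2 : 1 + x * r + z / x * (lam / n) * (S.card * aS + Sᶜ.card * aO) ≤ r := by linarith
    have hm3 : 1 + z / x * (lam / n) * (S.card * aS + Sᶜ.card * aO) ≤ aO := by linarith
    have hexp := PC.expected hh x z (lam/n) r aS aO hx0 (by linarith) hp0 hp1 hr0.le haS0.le haO0.le
      le_rfl (le_trans (le_of_eq (by congr!)) hm2) (le_trans (le_of_eq (by congr!)) hm3) (Fintype.card (Fin n × Fin n) + 1)
    have hfin : (Fintype.card (Fin n) : ℝ) * (z / x * (lam / n) * (aS + aO)) = q' * (aS + aO) := by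
      rw [hqq, Fintype.card_fin]; field_simp
    rw [hfin] at hexp
    calc _ ≤ ∑ ω : Slot h → Bool, 1 / Real.log z * (PC.pr h (lam/n) ω *
          ∑ a ∈ (Finset.univ : Finset (Fin n)) ×ˢ PC.LL (Fin n) (Fintype.card (Fin n × Fin n) + 1),
          (if PC.Good h S ω a.1 a.2 then
            PC.W h x (z/x) (s(a.2.getLastD a.1, a.1) :: PC.edgesL a.1 a.2) else 0)) := by
          apply Finset.sum_le_sum
          intro ω _
          obtain ⟨H, T, hT, hH, hop, hk⟩ := hmem ω
          have hd := PC.det hh hH hT.symm ω hop x z hx0 hx1 hz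
          rw [hk, mul_left_comm]
          apply mul_le_mul (le_of_eq _) _ (Nat.cast_nonneg _) (hprn ω)
          · unfold PC.pr; congr!
          · refine le_trans (le_of_eq ?_) hd; congr!
      _ ≤ C1 := by
          rw [← Finset.mul_sum, hC1]
          apply mul_le_mul_of_nonneg_left _ (by positivity)
          refine le_trans (le_of_eq ?_) hexp; congr!
      _ ≤ _ := le_add_of_nonneg_right (Nat.cast_nonneg _)
  · calc _ ≤ ∑ ω : Slot h → Bool, PC.pr h (lam/n) ω * (Nc : ℝ) := by
          apply Finset.sum_le_sum
          intro ω _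
          obtain ⟨H, T, hT, hH, hop, hk⟩ := hmem ω
          rw [hk]
          apply mul_le_mul (le_of_eq _) _ (Nat.cast_nonneg _) (hprn ω)
          · unfold PC.pr; congr!
          · have h1 : (symmDiff h.edgeFinset H.edgeFinset).card ≤ Fintype.card (Sym2 (Fin n)) :=
              Finset.card_le_univ _
            rw [Sym2.card, Fintype.card_fin] at h1
            have h2 : _ ≤ Nc := hNc ▸ h1.trans (Nat.choose_le_choose 2 (by omega))
            exact_mod_cast h2
      _ = (Nc : ℝ) := by
          rw [← Finset.sum_mul]
          have e1 : ∑ ω : Slot h → Bool, PC.pr h (lam/n) ω = 1 := by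
            refine Eq.trans ?_ hprs; congr!
          rw [e1, one_mul]
      _ ≤ _ := le_add_of_nonneg_left hC10
end

section
/- Let m ≥ 3 and 1 ≤ ℓ ≤ m be integers. Let N be the number of 2-regular simple graphs on the labeled vertex set {1,…,m} (simple graphs in which every vertex has degree exactly 2), and let N_ℓ be the number of those having at most ℓ connected components. Then N_ℓ · (1 + m·2^{−ℓ}) ≥ N. Equivalently, a uniformly random 2-regular simple graph on m labeled vertices has at most ℓ connected components (cycles) with probability at least 1/(1 + m·2^{−ℓ}). -/
/-- A `2`-regular simple graph: every vertex has exactly `2` neighbors. -/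
def TwoRegular {V : Type*} (G : SimpleGraph V) : Prop :=
  ∀ v, Nat.card {w : V // G.Adj v w} = 2

open SimpleGraph
section
variable {V : Type*} {G : SimpleGraph V}

theorem TwoRegular.other (h : TwoRegular G) (v u : V) (hu : G.Adj v u) :
    ∃ w, G.Adj v w ∧ w ≠ u ∧ ∀ x, G.Adj v x → x = u ∨ x = w := by
  obtain ⟨⟨a, ha⟩, ⟨b, hb⟩, hab, huniv⟩ := (Nat.card_eq_two_iff).1 (h v)
  have key : ∀ x, G.Adj v x → x = a ∨ x = b := by
    intro x hx
    have : (⟨x, hx⟩ : {w : V // G.Adj v w}) ∈ ({⟨a, ha⟩, ⟨b, hb⟩} : Set _) := by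
      rw [huniv]; trivial
    simpa using this
  have hab' : a ≠ b := fun e => hab (by simp [e])
  rcases key u hu with rfl | rfl
  · exact ⟨b, hb, hab'.symm, key⟩
  · exact ⟨a, ha, hab', fun x hx => (key x hx).symm⟩

/-- two distinct ways out of three neighbours coincide -/
theorem TwoRegular.three (h : TwoRegular G) {v a b c : V} (ha : G.Adj v a) (hb : G.Adj v b)
    (hc : G.Adj v c) (hab : a ≠ c) (hbc : b ≠ c) : a = b := by
  obtain ⟨w, -, -, hw⟩ := h.other v c hc
  rcases hw a ha with h1 | h1
  · exact absurd h1 hab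
  · rcases hw b hb with h2 | h2
    · exact absurd h2 hbc
    · rw [h1, h2]

noncomputable def nxt (h : TwoRegular G) (d : G.Dart) : G.Dart :=
  ⟨(d.snd, (h.other d.snd d.fst d.adj.symm).choose), (h.other d.snd d.fst d.adj.symm).choose_spec.1⟩

theorem nxt_fst (h : TwoRegular G) (d : G.Dart) : (nxt h d).fst = d.snd := rfl
theorem nxt_snd (h : TwoRegular G) (d : G.Dart) : (nxt h d).snd ≠ d.fst :=
  (h.other d.snd d.fst d.adj.symm).choose_spec.2.1

theorem dart_ext (d e : G.Dart) (h1 : d.fst = e.fst) (h2 : d.snd = e.snd) : d = e := by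
  apply SimpleGraph.Dart.ext; exact Prod.ext h1 h2

theorem nxt_eq (h : TwoRegular G) (d e : G.Dart) (h1 : e.fst = d.snd) (h2 : e.snd ≠ d.fst) :
    nxt h d = e := by
  apply dart_ext _ _ h1.symm
  exact h.three (v := d.snd) (nxt h d).adj (h1 ▸ e.adj) d.adj.symm (nxt_snd h d) h2

theorem nxt_symm (h : TwoRegular G) (d : G.Dart) : nxt h (nxt h d).symm = d.symm :=
  nxt_eq h _ _ rfl (fun e => nxt_snd h d e.symm)

noncomputable def nx (h : TwoRegular G) : Equiv.Perm G.Dart where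
  toFun := nxt h
  invFun d := (nxt h d.symm).symm
  left_inv d := by
    change (nxt h (nxt h d).symm).symm = d
    rw [nxt_symm]; exact d.symm_symm
  right_inv d := by
    have := nxt_symm h d.symm
    rwa [d.symm_symm] at this

theorem nx_symm (h : TwoRegular G) (d : G.Dart) : (nx h)⁻¹ d.symm = (nx h d).symm := by
  rw [Equiv.Perm.inv_eq_iff_eq]; exact (nxt_symm h d).symm

theorem nx_pow_symm (h : TwoRegular G) (n : ℕ) (d : G.Dart) :
    ((nx h)⁻¹ ^ n) d.symm = ((nx h ^ n) d).symm := by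
  induction n with
  | zero => rfl
  | succ n ih => rw [pow_succ', pow_succ', Equiv.Perm.mul_apply, ih, nx_symm, Equiv.Perm.mul_apply]

theorem no_nat (h : TwoRegular G) (n : ℕ) (d : G.Dart) : (nx h ^ n) d ≠ d.symm := by
  intro e
  obtain ⟨j, hj⟩ := Nat.even_or_odd' n
  have e2 : ((nx h)⁻¹ ^ j) ((nx h ^ n) d) = ((nx h ^ j) d).symm := by rw [e, nx_pow_symm]
  rcases hj with rfl | rfl
  · have : ((nx h)⁻¹ ^ j) ((nx h ^ (2 * j)) d) = (nx h ^ j) d := by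
      rw [← Equiv.Perm.mul_apply]; congr 1; rw [two_mul, pow_add]; simp
    rw [this] at e2
    exact SimpleGraph.Dart.symm_ne _ e2.symm
  · have : ((nx h)⁻¹ ^ j) ((nx h ^ (2 * j + 1)) d) = nx h ((nx h ^ j) d) := by
      rw [← Equiv.Perm.mul_apply, ← Equiv.Perm.mul_apply]; congr 1
      rw [two_mul, add_assoc, pow_add, pow_succ' _ j]; simp
    rw [this] at e2
    exact nxt_snd h ((nx h ^ j) d) (congrArg (fun x : G.Dart => x.snd) e2)

theorem no_same (h : TwoRegular G) (d : G.Dart) : ¬ (nx h).SameCycle d d.symm := by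
  rintro ⟨i, hi⟩
  obtain ⟨n, rfl | rfl⟩ := i.eq_nat_or_neg
  · exact no_nat h n d (by simpa using hi)
  · apply no_nat h n d.symm
    rw [← hi, zpow_neg, zpow_natCast]
    have h3 : (nx h ^ n) ((nx h ^ n)⁻¹ d) = d := (nx h ^ n).apply_symm_apply d
    rw [h3]
    have h4 : (nx h ^ n)⁻¹ d = d.symm := by rw [← hi, zpow_neg, zpow_natCast]
    rw [h4]; exact d.symm_symm.symm

theorem same_nx (h : TwoRegular G) (d : G.Dart) : (nx h).SameCycle d (nx h d) := ⟨1, by simp⟩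

theorem same_uniq (h : TwoRegular G) {d e : G.Dart} (hs : (nx h).SameCycle d e)
    (hf : d.fst = e.fst) : d = e := by
  by_contra hne
  have hsnd : d.snd ≠ e.snd := fun h2 => hne (dart_ext _ _ hf h2)
  have : nx h d.symm = e := nxt_eq h _ _ hf.symm hsnd.symm
  apply no_same h d
  have h2 := same_nx h d.symm
  rw [this] at h2
  exact hs.trans h2.symm

theorem same_cover (h : TwoRegular G) (d : G.Dart) {v : V} (hv : G.Reachable d.fst v) :
    ∃ e, (nx h).SameCycle d e ∧ e.fst = v := by
  obtain ⟨p⟩ := hv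
  suffices H : ∀ (u v : V) (p : G.Walk u v) (d : G.Dart), d.fst = u →
      ∃ e, (nx h).SameCycle d e ∧ e.fst = v from H _ _ p d rfl
  clear p d v
  intro u v p
  induction p with
  | nil => intro d hd; exact ⟨d, Equiv.Perm.SameCycle.refl _ _, hd⟩
  | @cons u w v huw p ih =>
    intro d hd
    by_cases hw : d.snd = w
    · obtain ⟨e, he, hev⟩ := ih (nx h d) hw
      exact ⟨e, (same_nx h d).trans he, hev⟩
    · subst hd
      have : nx h (⟨(w, d.fst), huw.symm⟩ : G.Dart) = d := nxt_eq h _ _ rfl hw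
      obtain ⟨e, he, hev⟩ := ih ⟨(w, d.fst), huw.symm⟩ rfl
      refine ⟨e, ?_, hev⟩
      have h2 := same_nx h (⟨(w, d.fst), huw.symm⟩ : G.Dart)
      rw [this] at h2
      exact h2.symm.trans he

theorem exists_dart (h : TwoRegular G) (v : V) : ∃ d : G.Dart, d.fst = v := by
  obtain ⟨⟨a, ha⟩, -⟩ := (Nat.card_eq_two_iff).1 (h v)
  exact ⟨⟨(v, a), ha⟩, rfl⟩

theorem exists_ori (h : TwoRegular G) : ∃ f : V → V, ∀ v, G.Adj v (f v) ∧ f (f v) ≠ v := by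
  have h1 : ∀ c : G.ConnectedComponent, ∃ d : G.Dart, G.connectedComponentMk d.fst = c := by
    intro c
    obtain ⟨v, rfl⟩ := c.exists_rep
    obtain ⟨d, rfl⟩ := exists_dart h v
    exact ⟨d, rfl⟩
  choose D hD using h1
  have h2 : ∀ v, ∃ e, (nx h).SameCycle (D (G.connectedComponentMk v)) e ∧ e.fst = v := fun v =>
    same_cover h _ (SimpleGraph.ConnectedComponent.eq.1 (hD _))
  choose E hE hEv using h2
  refine ⟨fun v => (E v).snd, fun v => ?_⟩
  have ha : G.Adj v (E v).snd := by
    have := (E v).adj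
    rwa [hEv] at this
  refine ⟨ha, ?_⟩
  have hc : G.connectedComponentMk (E v).snd = G.connectedComponentMk v :=
    SimpleGraph.ConnectedComponent.eq.2 ha.symm.reachable
  have : nx h (E v) = E (E v).snd := by
    apply same_uniq h
    · have := hE (E v).snd
      rw [hc] at this
      exact (same_nx h _).symm.trans ((hE v).symm.trans this)
    · rw [hEv]; rfl
  intro e
  have h3 := nxt_snd h (E v)
  apply h3
  have h4 : nxt h (E v) = E (E v).snd := this
  rw [h4, hEv v]
  exact e

def IsOri (G : SimpleGraph V) (f : V → V) : Prop := ∀ v, G.Adj v (f v) ∧ f (f v) ≠ v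

theorem IsOri.inj (h : TwoRegular G) {f : V → V} (hf : IsOri G f) : Function.Injective f := by
  intro a b hab
  refine h.three (v := f a) (c := f (f a)) (hf a).1.symm (hab ▸ (hf b).1.symm) (hf _).1
    (hf a).2.symm ?_
  rw [hab]; exact (hf b).2.symm

theorem IsOri.adj (h : TwoRegular G) {f : V → V} (hf : IsOri G f) (hs : Function.Surjective f)
    (u v : V) : G.Adj u v ↔ f u = v ∨ f v = u := by
  constructor
  · intro huv
    by_contra! hc
    obtain ⟨w, rfl⟩ := hs u
    have : v = w := h.three huv (hf w).1.symm (hf _).1 hc.1.symm (hf w).2.symm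
    exact hc.2 (by rw [this])
  · rintro (rfl | rfl)
    · exact (hf _).1
    · exact (hf _).1.symm

theorem exists_many [Finite V] (h : TwoRegular G) :
    ∃ F : (G.ConnectedComponent → Bool) → Equiv.Perm V,
      Function.Injective F ∧ ∀ S, IsOri G (F S) := by
  obtain ⟨f, hf⟩ := exists_ori h
  have hf : IsOri G f := hf
  let σ : Equiv.Perm V := Equiv.ofBijective f (Finite.injective_iff_bijective.1 (hf.inj h))
  have hσ : ∀ v, σ v = f v := fun v => rfl
  have hσo : IsOri G σ := hf
  have hinv : ∀ w, (σ⁻¹ : Equiv.Perm V) (σ w) = w := σ.symm_apply_apply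
  have hτo : IsOri G (σ⁻¹ : Equiv.Perm V) := by
    intro v
    obtain ⟨w, rfl⟩ := σ.surjective v
    obtain ⟨u, rfl⟩ := σ.surjective w
    simp only [hinv]
    exact ⟨(hσo _).1.symm, (hσo _).2.symm⟩
  have hne : ∀ v, σ v ≠ σ⁻¹ v := by
    intro v e
    obtain ⟨w, rfl⟩ := σ.surjective v
    rw [hinv] at e
    exact (hσo _).2 e
  let g : (G.ConnectedComponent → Bool) → V → V := fun S v =>
    if S (G.connectedComponentMk v) then σ v else σ⁻¹ v
  have hg : ∀ S, IsOri G (g S) := by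
    intro S v
    have hadj : G.Adj v (g S v) := by
      by_cases hS : S (G.connectedComponentMk v)
      · simpa [g, hS] using (hσo v).1
      · simpa [g, hS] using (hτo v).1
    refine ⟨hadj, ?_⟩
    have hc : G.connectedComponentMk (g S v) = G.connectedComponentMk v :=
      SimpleGraph.ConnectedComponent.eq.2 hadj.symm.reachable
    show (if S (G.connectedComponentMk (g S v)) then _ else _) ≠ v
    rw [hc]
    by_cases hS : S (G.connectedComponentMk v)
    · simpa [g, hS] using (hσo v).2
    · simpa [g, hS] using (hτo v).2
  refine ⟨fun S => Equiv.ofBijective (g S) (Finite.injective_iff_bijective.1 ((hg S).inj h)), ?_, hg⟩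
  intro S T hST
  funext c
  obtain ⟨v, rfl⟩ := c.exists_rep
  have : g S v = g T v := congrArg (fun s : Equiv.Perm V => s v) hST
  have h1 := hne v
  change S (G.connectedComponentMk v) = T (G.connectedComponentMk v)
  simp only [g] at this
  cases hS : S (G.connectedComponentMk v) <;> cases hT : T (G.connectedComponentMk v) <;>
    simp_all

theorem part1 [Finite V] (ℓ : ℕ) :
    Nat.card {G : SimpleGraph V // TwoRegular G ∧ ¬ Nat.card G.ConnectedComponent ≤ ℓ} * 2 ^ (ℓ + 1)
      ≤ Nat.card (Equiv.Perm V) := by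
  classical
  let A := {G : SimpleGraph V // TwoRegular G ∧ ¬ Nat.card G.ConnectedComponent ≤ ℓ}
  have : Fintype A := Fintype.ofFinite _
  choose F hF hFo using fun G : A => exists_many G.2.1
  let Φ : (Σ G : A, (G.1.ConnectedComponent → Bool)) → Equiv.Perm V := fun x => F x.1 x.2
  have hΦ : Function.Injective Φ := by
    rintro ⟨G, S⟩ ⟨H, T⟩ e
    have e : F G S = F H T := e
    have : G = H := by
      apply Subtype.ext
      ext u v
      rw [(hFo G S).adj G.2.1 (Equiv.surjective _), (hFo H T).adj H.2.1 (Equiv.surjective _), e]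
    subst this
    rw [hF G e]
  refine le_trans ?_ (Nat.card_le_card_of_injective Φ hΦ)
  rw [Nat.card_sigma]
  calc Nat.card A * 2 ^ (ℓ + 1) = ∑ G : A, 2 ^ (ℓ + 1) := by simp [Nat.card_eq_fintype_card]
    _ ≤ _ := by
      apply Finset.sum_le_sum
      intro G _
      rw [Nat.card_fun]
      simp only [Nat.card_eq_fintype_card (α := Bool), Fintype.card_bool]
      exact Nat.pow_le_pow_right (by norm_num) (not_le.1 G.2.2)
end

theorem cyc_two (n : ℕ) : TwoRegular (cycleGraph (n + 3)) := by
  intro v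
  have := cycleGraph_degree_three_le (n := n) (v := v)
  rw [← this, ← SimpleGraph.card_neighborSet_eq_degree, Nat.card_eq_fintype_card]
  rfl

theorem part2 (n ℓ : ℕ) (hℓ : 1 ≤ ℓ) :
    Nat.card (Equiv.Perm (Fin (n + 3))) ≤
    Nat.card {G : SimpleGraph (Fin (n + 3)) // TwoRegular G ∧ Nat.card G.ConnectedComponent ≤ ℓ} *
      (2 * (n + 3)) := by
  classical
  let B := {G : SimpleGraph (Fin (n + 3)) // TwoRegular G ∧ Nat.card G.ConnectedComponent ≤ ℓ}
  have : Fintype B := Fintype.ofFinite _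
  let gr : Equiv.Perm (Fin (n + 3)) → SimpleGraph (Fin (n + 3)) :=
    fun σ => (cycleGraph (n + 3)).comap σ.symm
  have hadj : ∀ σ u v, (gr σ).Adj (σ u) (σ v) ↔ (cycleGraph (n + 3)).Adj u v := by
    intro σ u v; simp [gr]
  let iso : ∀ σ, cycleGraph (n + 3) ≃g gr σ := fun σ => ⟨σ, by intro u v; exact hadj σ u v⟩
  have hgr : ∀ σ, TwoRegular (gr σ) ∧ Nat.card (gr σ).ConnectedComponent ≤ ℓ := by
    intro σ
    constructor
    · intro v
      obtain ⟨u, rfl⟩ := σ.surjective v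
      rw [← cyc_two n u]
      refine Nat.card_congr (Equiv.subtypeEquiv σ ?_).symm
      intro w; exact (hadj σ u w).symm
    · have hc : (gr σ).Connected := (iso σ).connected_iff.1 cycleGraph_connected
      have : Subsingleton (gr σ).ConnectedComponent := hc.preconnected.subsingleton_connectedComponent
      exact le_trans (Finite.card_le_one_iff_subsingleton.2 this) hℓ
  have hstep : ∀ k (hk : k + 1 < n + 3), (cycleGraph (n + 3)).Adj ⟨k, by omega⟩ ⟨k + 1, hk⟩ := by
    intro k hk
    rw [cycleGraph_adj]
    right
    simp [Fin.ext_iff, Fin.sub_val_of_le]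
  let Ψ : Equiv.Perm (Fin (n + 3)) → Σ G : B, Σ v, {w // G.1.Adj v w} := fun σ =>
    ⟨⟨gr σ, hgr σ⟩, σ ⟨0, by omega⟩, σ ⟨1, by omega⟩, (hadj _ _ _).2 (hstep 0 (by omega))⟩
  have hΨ : Function.Injective Ψ := by
    intro σ τ e
    have e1 : gr σ = gr τ := congrArg (fun x => x.1.1) e
    have e2 : σ ⟨0, by omega⟩ = τ ⟨0, by omega⟩ := congrArg (fun x => x.2.1) e
    have e3 : σ ⟨1, by omega⟩ = τ ⟨1, by omega⟩ := congrArg (fun x => x.2.2.1) e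
    have key : ∀ k (hk : k + 1 < n + 3), σ ⟨k, by omega⟩ = τ ⟨k, by omega⟩ ∧
        σ ⟨k + 1, hk⟩ = τ ⟨k + 1, hk⟩ := by
      intro k
      induction k with
      | zero => intro _; exact ⟨e2, e3⟩
      | succ k ih =>
        intro hk
        obtain ⟨i1, i2⟩ := ih (by omega)
        refine ⟨i2, ?_⟩
        have a1 : (gr σ).Adj (σ ⟨k + 1, by omega⟩) (σ ⟨k + 2, hk⟩) :=
          (hadj _ _ _).2 (hstep (k + 1) hk)
        have a2 : (gr σ).Adj (σ ⟨k + 1, by omega⟩) (τ ⟨k + 2, hk⟩) := by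
          rw [e1, i2]; exact (hadj _ _ _).2 (hstep (k + 1) hk)
        have a3 : (gr σ).Adj (σ ⟨k + 1, by omega⟩) (σ ⟨k, by omega⟩) :=
          (hadj _ _ _).2 (hstep k (by omega)).symm
        refine (hgr σ).1.three a1 a2 a3 ?_ ?_
        · simp; omega
        · rw [i1]; simp; omega
    ext i
    congr 1
    by_cases hi : i.1 + 1 < n + 3
    · exact (key i.1 hi).1
    · have := (key (n + 1) (by omega)).2
      have hi2 : i = ⟨n + 1 + 1, by omega⟩ := Fin.ext (by have := i.2; simp; omega)
      rw [hi2]; exact this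
  refine le_trans (Nat.card_le_card_of_injective Ψ hΨ) (le_of_eq ?_)
  rw [Nat.card_sigma]
  have : ∀ G : B, Nat.card (Σ v, {w // G.1.Adj v w}) = 2 * (n + 3) := by
    intro G
    rw [Nat.card_sigma, Finset.sum_congr rfl (fun v _ => G.2.1 v)]
    simp [mul_comm]
  rw [Finset.sum_congr rfl (fun G _ => this G)]
  simp [Nat.card_eq_fintype_card, B]

/-- for `3 ≤ m` and `1 ≤ ℓ ≤ m`, letting `N` be the number of `2`-regular
simple graphs on `m` labeled vertices and `N_ℓ` the number of those with at most `ℓ`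
connected components, one has `N ≤ N_ℓ·(1 + m·2^{−ℓ})`; equivalently a uniformly random
`2`-regular graph has at most `ℓ` cycles with probability at least `1/(1 + m·2^{−ℓ})`. -/
theorem stmt10 (m ℓ : ℕ) (hm : 3 ≤ m) (hℓ1 : 1 ≤ ℓ) (hℓm : ℓ ≤ m) :
    (Nat.card {G : SimpleGraph (Fin m) // TwoRegular G} : ℝ)
      ≤ (Nat.card {G : SimpleGraph (Fin m) //
            TwoRegular G ∧ Nat.card G.ConnectedComponent ≤ ℓ} : ℝ)
        * (1 + (m : ℝ) / 2^ℓ) := by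
  classical
  obtain ⟨n, rfl⟩ : ∃ n, m = n + 3 := ⟨m - 3, by omega⟩
  have h1 := part1 (V := Fin (n + 3)) ℓ
  have h2 := part2 n ℓ hℓ1
  have h3 : Nat.card {G : SimpleGraph (Fin (n + 3)) // TwoRegular G} =
      Nat.card {G : SimpleGraph (Fin (n + 3)) //
            TwoRegular G ∧ Nat.card G.ConnectedComponent ≤ ℓ} +
      Nat.card {G : SimpleGraph (Fin (n + 3)) //
            TwoRegular G ∧ ¬ Nat.card G.ConnectedComponent ≤ ℓ} := by
    simp only [Nat.card_eq_fintype_card, Fintype.card_subtype]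
    rw [← Finset.filter_filter, ← Finset.filter_filter, Finset.card_filter_add_card_filter_not]
  rw [h3]
  have h4 := h1.trans h2
  generalize Nat.card {G : SimpleGraph (Fin (n + 3)) //
            TwoRegular G ∧ Nat.card G.ConnectedComponent ≤ ℓ} = a at *
  generalize Nat.card {G : SimpleGraph (Fin (n + 3)) //
            TwoRegular G ∧ ¬ Nat.card G.ConnectedComponent ≤ ℓ} = b at *
  have h5 : (b : ℝ) * 2 ^ (ℓ + 1) ≤ a * (2 * ((n + 3 : ℕ) : ℝ)) := by exact_mod_cast h4
  have h6 : (b : ℝ) ≤ a * ((n + 3 : ℕ) : ℝ) / 2 ^ ℓ := by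
    rw [le_div_iff₀ (by positivity)]
    rw [pow_succ] at h5
    linarith
  push_cast at h6 ⊢
  rw [mul_add, mul_one, mul_div_assoc'] 
  linarith
end

section
/- Let m ≥ 3 and ℓ ≥ 0 be integers. Then the number of 2-regular simple graphs on the labeled vertex set {1,…,m} having more than ℓ connected components is at most m!/2^{ℓ+1}; that is, 2^{ℓ+1} times that number is at most m!. -/
lemma comp_perm {V : Type*} [Finite V] {G : SimpleGraph V} (h : TwoRegular G)
    (c : G.ConnectedComponent) :
    ∃ τ : Equiv.Perm V, ∀ v, G.connectedComponentMk v = c → G.Adj v (τ v) ∧ τ (τ v) ≠ v := by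
  classical
  obtain ⟨u, rfl⟩ := c.exists_rep
  have hc : G.IsCycles := fun v _ => h v
  have hn : (G.neighborSet u).Nonempty := by
    apply Set.nonempty_of_ncard_ne_zero
    have : (G.neighborSet u).ncard = 2 := h u
    omega
  obtain ⟨p, hp, hs⟩ := hc.exists_cycle_toSubgraph_verts_eq_connectedComponentSupp
    (c := G.connectedComponentMk u) (v := u) rfl hn
  have h3 := hp.three_le_length
  have hnd := hp.support_nodup
  have hlen : p.support.tail.length = p.length := by simp
  have hget : ∀ i (hi : i < p.support.tail.length), p.support.tail[i] = p.getVert (i+1) := by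
    intro i hi
    simp [SimpleGraph.Walk.support_getElem_eq_getVert]
  have hmem : ∀ v, G.connectedComponentMk v = G.connectedComponentMk u → v ∈ p.support.tail := by
    intro v hv
    have h1 : v ∈ (G.connectedComponentMk u).supp := hv
    rw [← hs, SimpleGraph.Walk.mem_verts_toSubgraph] at h1
    rw [SimpleGraph.Walk.mem_support_iff] at h1
    rcases h1 with rfl | h1
    · exact SimpleGraph.Walk.end_mem_tail_support hp.not_nil
    · exact h1
  refine ⟨p.support.tail.formPerm, fun v hv => ?_⟩
  obtain ⟨i, hi, rfl⟩ := List.getElem_of_mem (hmem v hv)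
  constructor
  · rw [List.formPerm_apply_getElem _ hnd, hget, hget]
    rcases Nat.lt_or_ge (i+1) p.support.tail.length with h1 | h1
    · rw [Nat.mod_eq_of_lt h1]
      exact p.adj_getVert_succ (by omega)
    · have h2 : i + 1 = p.support.tail.length := by omega
      have h4 : p.getVert (i+1) = p.getVert 0 := by
        rw [h2, hlen]; simp
      rw [h4, h2, Nat.mod_self]
      exact p.adj_getVert_succ (by omega)
  · rw [List.formPerm_apply_getElem _ hnd, List.formPerm_apply_getElem _ hnd]
    rw [Ne, hnd.getElem_inj_iff]
    rw [← hlen] at h3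
    clear hget hv hmem
    generalize p.support.tail.length = n at *
    rcases Nat.lt_or_ge (i+1) n with h1 | h1
    · rw [Nat.mod_eq_of_lt h1]
      rcases Nat.lt_or_ge (i+1+1) n with h2 | h2
      · rw [Nat.mod_eq_of_lt h2]; omega
      · have : i+1+1 = n := by omega
        rw [this, Nat.mod_self]; omega
    · have h2 : i + 1 = n := by omega
      rw [h2, Nat.mod_self, Nat.mod_eq_of_lt (by omega)]; omega

lemma exists_orient {V : Type*} [Finite V] {G : SimpleGraph V} (h : TwoRegular G) :
    ∃ σ : Equiv.Perm V, (∀ v, σ (σ v) ≠ v) ∧ ∀ v w, G.Adj v w ↔ σ v = w ∨ σ w = v := by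
  classical
  choose τ hτ using comp_perm h
  have hadj : ∀ v, G.Adj v (τ (G.connectedComponentMk v) v) := fun v => (hτ _ v rfl).1
  have hcc : ∀ v, G.connectedComponentMk (τ (G.connectedComponentMk v) v)
      = G.connectedComponentMk v := fun v =>
    (SimpleGraph.ConnectedComponent.connectedComponentMk_eq_of_adj (hadj v)).symm
  have hinj : Function.Injective (fun v => τ (G.connectedComponentMk v) v) := by
    intro v w hvw
    simp only at hvw
    have h1 : G.connectedComponentMk v = G.connectedComponentMk w := by
      rw [← hcc v, ← hcc w, hvw]
    rw [h1] at hvw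
    exact (τ _).injective hvw
  obtain ⟨σ, hσ⟩ : ∃ σ : Equiv.Perm V, ∀ v, σ v = τ (G.connectedComponentMk v) v :=
    ⟨Equiv.ofBijective _ (Finite.injective_iff_bijective.mp hinj), fun v => rfl⟩
  have hne : ∀ v, σ (σ v) ≠ v := by
    intro v
    rw [hσ (σ v), hσ v, hcc]
    exact (hτ _ v rfl).2
  have ha : ∀ v, G.Adj v (σ v) := fun v => by rw [hσ]; exact hadj v
  refine ⟨σ, hne, fun v w => ⟨fun hvw => ?_, ?_⟩⟩
  · have h2 : (G.neighborSet v).ncard = 2 := h v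
    obtain ⟨x, y, -, hxy⟩ := Set.ncard_eq_two.mp h2
    have m1 : σ v ∈ G.neighborSet v := ha v
    have m2 : σ.symm v ∈ G.neighborSet v := by
      have := (ha (σ.symm v)).symm
      simpa using this
    have m3 : w ∈ G.neighborSet v := hvw
    have hd : σ v ≠ σ.symm v := by
      intro he
      apply hne v
      rw [he]; simp
    rw [hxy] at m1 m2 m3
    have : w = σ v ∨ w = σ.symm v := by
      simp only [Set.mem_insert_iff, Set.mem_singleton_iff] at m1 m2 m3
      grind
    rcases this with rfl | rfl
    · left; rfl
    · right; simp
  · rintro (rfl | rfl)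
    · exact ha v
    · exact (ha w).symm

lemma exists_flips {V : Type*} [Finite V] {G : SimpleGraph V} (h : TwoRegular G) :
    ∃ F : (G.ConnectedComponent → Bool) → Equiv.Perm V, Function.Injective F ∧
      ∀ s v w, G.Adj v w ↔ F s v = w ∨ F s w = v := by
  classical
  obtain ⟨σ, hne, hσ⟩ := exists_orient h
  let f : (G.ConnectedComponent → Bool) → V → V := fun s v =>
    if s (G.connectedComponentMk v) then σ v else σ.symm v
  have ha : ∀ s v, G.Adj v (f s v) := by
    intro s v
    rw [hσ]
    by_cases hs : s (G.connectedComponentMk v) <;> simp [f, hs]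
  have hcc : ∀ s v, G.connectedComponentMk (f s v) = G.connectedComponentMk v := fun s v =>
    (SimpleGraph.ConnectedComponent.connectedComponentMk_eq_of_adj (ha s v)).symm
  have hinj : ∀ s, Function.Injective (f s) := by
    intro s v w hvw
    have h1 : G.connectedComponentMk v = G.connectedComponentMk w := by
      rw [← hcc s v, ← hcc s w, hvw]
    simp only [f, h1] at hvw
    split_ifs at hvw
    · exact σ.injective hvw
    · exact σ.symm.injective hvw
  refine ⟨fun s => Equiv.ofBijective (f s) (Finite.injective_iff_bijective.mp (hinj s)), ?_, ?_⟩
  · intro s t hst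
    funext c
    obtain ⟨v, rfl⟩ := c.exists_rep
    change s (G.connectedComponentMk v) = t (G.connectedComponentMk v)
    have h1 : f s v = f t v := congrArg (fun e : Equiv.Perm V => e v) hst
    have hd : σ v ≠ σ.symm v := by
      intro he
      apply hne v
      rw [he]; simp
    simp only [f] at h1
    cases hs : s (G.connectedComponentMk v) <;> cases ht : t (G.connectedComponentMk v) <;>
      simp_all
  · intro s v w
    simp only [Equiv.ofBijective_apply]
    constructor
    · intro hvw
      have h1 := SimpleGraph.ConnectedComponent.connectedComponentMk_eq_of_adj hvw
      have h2 := (hσ v w).mp hvw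
      simp only [f, h1]
      split_ifs
      · exact h2
      · rw [Equiv.symm_apply_eq, Equiv.symm_apply_eq]
        tauto
    · rintro (rfl | rfl)
      · exact ha s v
      · exact (ha s w).symm

/-- for `m ≥ 3` and `ℓ ≥ 0`, the number of `2`-regular simple graphs on `m`
labeled vertices with more than `ℓ` connected components is at most `m!/2^{ℓ+1}`, i.e.
`2^{ℓ+1}` times that number is at most `m!`. -/
theorem stmt11 (m ℓ : ℕ) (hm : 3 ≤ m) :
    2^(ℓ+1) * Nat.card {G : SimpleGraph (Fin m) //
        TwoRegular G ∧ ℓ < Nat.card G.ConnectedComponent}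
      ≤ m.factorial := by
  classical
  have key : ∀ G : {G : SimpleGraph (Fin m) //
        TwoRegular G ∧ ℓ < Nat.card G.ConnectedComponent},
      ∃ F : (Fin (ℓ+1) → Bool) → Equiv.Perm (Fin m), Function.Injective F ∧
      ∀ s v w, G.1.Adj v w ↔ F s v = w ∨ F s w = v := by
    rintro ⟨G, h, hl⟩
    obtain ⟨F, hF, hF'⟩ := exists_flips h
    let e := Finite.equivFin G.ConnectedComponent
    let j : Fin (ℓ+1) → G.ConnectedComponent := fun i => e.symm (Fin.castLE hl i)
    have hj : Function.Injective j := e.symm.injective.comp (Fin.castLE_injective hl)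
    refine ⟨fun s => F (Function.extend j s (fun _ => false)), ?_, fun s => hF' _⟩
    intro s t hst
    have h1 := hF hst
    funext i
    have h2 := congrFun h1 (j i)
    rwa [hj.extend_apply, hj.extend_apply] at h2
  choose F hF hF' using key
  have hinj : Function.Injective (fun x : (Fin (ℓ+1) → Bool) × {G : SimpleGraph (Fin m) //
        TwoRegular G ∧ ℓ < Nat.card G.ConnectedComponent} => F x.2 x.1) := by
    rintro ⟨s, G⟩ ⟨t, H⟩ hst
    simp only at hst
    have hGH : G = H := by
      apply Subtype.ext
      ext v w
      rw [hF' G s, hF' H t, hst]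
    subst hGH
    rw [hF G hst]
  have := Nat.card_le_card_of_injective _ hinj
  rw [Nat.card_prod, Nat.card_perm] at this
  simpa using this
end

section
/- Let (Ω, ℱ, ℙ) be a probability space, let μ > 1 and σ ≥ 0 be real numbers, and let Z : ℕ → Ω → ℕ be a sequence of random variables with Z₀ = 1 almost surely and E[Z_m²] < ∞ for every m. Suppose that for every m ≥ 1, the conditional expectations given the σ-algebra generated by Z_{m−1} satisfy E[Z_m ∣ Z_{m−1}] = μ·Z_{m−1} almost surely and E[Z_m² ∣ Z_{m−1}] = μ²·Z_{m−1}² + σ²·Z_{m−1} almost surely. Then for every m, ℙ(Z_m ≥ 1) ≥ (μ² − μ)/(μ² − μ + σ²). -/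
open MeasureTheory

/-- survival probability of a (history-dependent) supercritical branching
process. If `Z₀ = 1` a.s., `E[Z_m²] < ∞`, and the conditional first and second moments of
`Z_m` given (the σ-algebra generated by) `Z_{m−1}` are `μ·Z_{m−1}` and
`μ²·Z_{m−1}² + σ²·Z_{m−1}`, then `ℙ(Z_m ≥ 1) ≥ (μ² − μ)/(μ² − μ + σ²)` for every `m`. -/
theorem stmt14 {Ω : Type*} [MeasurableSpace Ω] (P : Measure Ω) [IsProbabilityMeasure P]
    (μ σ : ℝ) (hμ : 1 < μ) (hσ : 0 ≤ σ)
    (Z : ℕ → Ω → ℕ) (hmeas : ∀ m, Measurable (Z m))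
    (hZ0 : ∀ᵐ ω ∂P, Z 0 ω = 1)
    (hint : ∀ m, Integrable (fun ω => ((Z m ω : ℝ))^2) P)
    (hcond1 : ∀ m : ℕ, 1 ≤ m →
      P[(fun ω => (Z m ω : ℝ)) | MeasurableSpace.comap (Z (m-1)) ⊤]
        =ᵐ[P] fun ω => μ * (Z (m-1) ω : ℝ))
    (hcond2 : ∀ m : ℕ, 1 ≤ m →
      P[(fun ω => ((Z m ω : ℝ))^2) | MeasurableSpace.comap (Z (m-1)) ⊤]
        =ᵐ[P] fun ω => μ^2 * ((Z (m-1) ω : ℝ))^2 + σ^2 * (Z (m-1) ω : ℝ)) :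
    ∀ m : ℕ, (μ^2 - μ) / (μ^2 - μ + σ^2) ≤ (P {ω | 1 ≤ Z m ω}).toReal := by
  have hle : ∀ m, MeasurableSpace.comap (Z m) ⊤ ≤ (inferInstance : MeasurableSpace Ω) :=
    fun m => (hmeas m).comap_le
  have hmR : ∀ m, Measurable (fun ω => (Z m ω : ℝ)) := fun m =>
    measurable_from_top.comp (hmeas m)
  have hint1 : ∀ m, Integrable (fun ω => (Z m ω : ℝ)) P := by
    intro m
    refine (hint m).mono (hmR m).aestronglyMeasurable (Filter.Eventually.of_forall fun ω => ?_)
    simp only [Real.norm_eq_abs, abs_pow, Nat.abs_cast]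
    exact_mod_cast Nat.le_self_pow two_ne_zero (Z m ω)
  have h1 : ∀ m, ∫ ω, (Z m ω : ℝ) ∂P = μ ^ m := by
    intro m
    induction m with
    | zero =>
      have : ∫ ω, (Z 0 ω : ℝ) ∂P = ∫ ω, (1 : ℝ) ∂P := by
        apply integral_congr_ae
        filter_upwards [hZ0] with ω h
        simp [h]
      simp [this]
    | succ k ih =>
      have h := integral_congr_ae (hcond1 (k + 1) (by omega))
      rw [integral_condExp (hle _), Nat.add_sub_cancel, integral_const_mul, ih] at h
      rw [h]; ring
  have h2 : ∀ m, (μ ^ 2 - μ) * ∫ ω, (Z m ω : ℝ) ^ 2 ∂P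
      = (μ ^ m) ^ 2 * (μ ^ 2 - μ + σ ^ 2) - σ ^ 2 * μ ^ m := by
    intro m
    induction m with
    | zero =>
      have : ∫ ω, (Z 0 ω : ℝ) ^ 2 ∂P = ∫ ω, (1 : ℝ) ∂P := by
        apply integral_congr_ae
        filter_upwards [hZ0] with ω h
        simp [h]
      simp [this]
    | succ k ih =>
      have h := integral_congr_ae (hcond2 (k + 1) (by omega))
      rw [integral_condExp (hle _), Nat.add_sub_cancel,
        integral_add ((hint k).const_mul _) ((hint1 k).const_mul _),
        integral_const_mul, integral_const_mul, h1] at h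
      rw [h]
      linear_combination μ ^ 2 * ih
  intro m
  have hS : MeasurableSet {ω | 1 ≤ Z m ω} := hmeas m measurableSet_Ici
  have hD : 0 < μ ^ 2 - μ := by nlinarith
  have hE : 0 < μ ^ 2 - μ + σ ^ 2 := by positivity
  have hM : 0 < μ ^ m := by positivity
  have key : ∀ t : ℝ, 2 * t * μ ^ m - t ^ 2 * ∫ ω, (Z m ω : ℝ) ^ 2 ∂P
      ≤ (P {ω | 1 ≤ Z m ω}).toReal := by
    intro t
    have e : ∫ ω, ({ω | 1 ≤ Z m ω}.indicator (fun _ => (1 : ℝ))) ω ∂P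
        = (P {ω | 1 ≤ Z m ω}).toReal := by
      rw [integral_indicator_const _ hS]; simp [Measure.real]
    rw [← e, ← h1 m, ← integral_const_mul, ← integral_const_mul,
      ← integral_sub ((hint1 m).const_mul _) ((hint m).const_mul _)]
    apply integral_mono (((hint1 m).const_mul _).sub ((hint m).const_mul _))
      ((integrable_const _).indicator hS)
    intro ω
    by_cases hz : 1 ≤ Z m ω
    · simp only [Set.indicator, Set.mem_ofPred_eq, hz, if_true, Pi.sub_apply]
      nlinarith [sq_nonneg (1 - t * (Z m ω : ℝ))]
    · have hz0 : Z m ω = 0 := by omega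
      simp [Set.indicator, hz0]
  have hk := key ((μ ^ 2 - μ) / (μ ^ 2 - μ + σ ^ 2) / μ ^ m)
  refine le_trans ?_ hk
  have ha : ∫ ω, (Z m ω : ℝ) ^ 2 ∂P
      ≤ (μ ^ m) ^ 2 * (μ ^ 2 - μ + σ ^ 2) / (μ ^ 2 - μ) := by
    rw [le_div_iff₀ hD]
    have := h2 m
    have : 0 ≤ σ ^ 2 * μ ^ m := by positivity
    linarith
  have hb := mul_le_mul_of_nonneg_left ha
    (sq_nonneg ((μ ^ 2 - μ) / (μ ^ 2 - μ + σ ^ 2) / μ ^ m))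
  generalize μ ^ 2 - μ = D at *
  generalize μ ^ m = M at *
  have e1 : (D / (D + σ ^ 2) / M) ^ 2 * (M ^ 2 * (D + σ ^ 2) / D) = D / (D + σ ^ 2) := by
    field_simp
  have e2 : 2 * (D / (D + σ ^ 2) / M) * M = 2 * (D / (D + σ ^ 2)) := by
    field_simp
  rw [e1] at hb
  rw [e2]
  linarith
end

section
/- Let λ ≥ 0 and β > 0 be real numbers with α := (e^β − 1)/β ≥ 3/2, let N be a natural number, and let r be a real number with 0 ≤ r ≤ β/(α(λ+2))^N. Suppose M : ℕ → ℝ satisfies M(0) ≤ e^r, M(j) ≥ 0 for all j, and M(j+1) ≤ M(j)² · exp(r − λ + λ·M(j)) for all j < N. Then M(j) ≤ exp((α(λ+2))^j · r) for every j ≤ N. -/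
/-- the MGF recursion bound. Let `λ ≥ 0`, `β > 0`, `α = (e^β − 1)/β ≥ 3/2`,
`N : ℕ`, `0 ≤ r ≤ β/(α(λ+2))^N`. If `M : ℕ → ℝ` satisfies `M 0 ≤ e^r`, `M j ≥ 0`, and
`M (j+1) ≤ (M j)² · exp(r − λ + λ·M j)` for `j < N`, then `M j ≤ exp((α(λ+2))^j · r)` for
all `j ≤ N`. -/
theorem stmt16 (lam β : ℝ) (hlam : 0 ≤ lam) (hβ : 0 < β)
    (α : ℝ) (hα : α = (Real.exp β - 1) / β) (hα32 : 3/2 ≤ α)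
    (N : ℕ) (r : ℝ) (hr0 : 0 ≤ r) (hr : r ≤ β / (α * (lam + 2))^N)
    (M : ℕ → ℝ) (hM0 : M 0 ≤ Real.exp r) (hMnn : ∀ j, 0 ≤ M j)
    (hrec : ∀ j < N, M (j+1) ≤ (M j)^2 * Real.exp (r - lam + lam * M j)) :
    ∀ j ≤ N, M j ≤ Real.exp ((α * (lam + 2))^j * r) := by
  have hK1 : 1 ≤ α * (lam + 2) := by nlinarith
  have hKN : 0 < (α * (lam + 2))^N := by positivity
  have hrN : (α * (lam + 2))^N * r ≤ β := by
    rw [le_div_iff₀ hKN] at hr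
    linarith
  have hαβ : α * β = Real.exp β - 1 := by
    rw [hα]; field_simp
  have key : ∀ x, 0 ≤ x → x ≤ β → Real.exp x - 1 ≤ α * x := by
    intro x hx0 hxβ
    have h1 : 0 ≤ 1 - x / β := by
      rw [sub_nonneg, div_le_one hβ]; exact hxβ
    have h2 : 0 ≤ x / β := by positivity
    have h := convexOn_exp.2 (Set.mem_univ 0) (Set.mem_univ β) h1 h2 (by ring)
    simp only [smul_eq_mul, mul_zero, zero_add, Real.exp_zero, mul_one] at h
    have h3 : x / β * β = x := by field_simp
    have h4 : α * x = x / β * (Real.exp β - 1) := by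
      rw [← hαβ]; field_simp
    rw [h3] at h
    linarith
  intro j
  induction j with
  | zero => intro _; simpa using hM0
  | succ j ih =>
    intro hj
    have hM := ih (by omega)
    have h1 : 1 ≤ (α * (lam + 2))^j := one_le_pow₀ hK1
    have hrx : r ≤ (α * (lam + 2))^j * r := by nlinarith
    have hxβ : (α * (lam + 2))^j * r ≤ β :=
      le_trans (mul_le_mul_of_nonneg_right (pow_le_pow_right₀ hK1 (by omega)) hr0) hrN
    have hpow : (α * (lam + 2))^(j+1) * r = α * (lam + 2) * ((α * (lam + 2))^j * r) := by ring
    rw [hpow]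
    generalize (α * (lam + 2))^j * r = x at *
    have hx0 : 0 ≤ x := le_trans hr0 hrx
    have hk := key x hx0 hxβ
    have hsq : (M j)^2 ≤ Real.exp (2 * x) := by
      have : Real.exp (2 * x) = (Real.exp x)^2 := by rw [← Real.exp_nat_mul]; norm_num
      rw [this]
      exact pow_le_pow_left₀ (hMnn j) hM 2
    have hl : lam * M j ≤ lam * (1 + α * x) :=
      mul_le_mul_of_nonneg_left (by linarith) hlam
    calc M (j+1) ≤ (M j)^2 * Real.exp (r - lam + lam * M j) := hrec j (by omega)
      _ ≤ Real.exp (2 * x) * Real.exp (r - lam + lam * (1 + α * x)) := by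
        apply mul_le_mul hsq (Real.exp_le_exp.2 (by linarith)) (Real.exp_pos _).le (Real.exp_pos _).le
      _ = Real.exp (2 * x + (r - lam + lam * (1 + α * x))) := (Real.exp_add _ _).symm
      _ ≤ _ := by
        apply Real.exp_le_exp.2
        nlinarith [mul_le_mul_of_nonneg_right hα32 hx0]
end
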